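/- arXiv:1906.10051 — 5 statements merged into one kernel-verified Lean document; each statement's English description precedes it below -/
import Mathlib

section
/- Let E be a finite-dimensional real inner product space, let A, B : E → E be self-adjoint linear maps, and let u : E → ℝ. The following are equivalent: (1) Hu ≥ A and Hu ≤ B; (2) for every x ∈ E there exists y ∈ E such that (1/2)⟨A(x'−x), x'−x⟩ ≤ u(x') − u(x) − ⟨y, x'−x⟩ ≤ (1/2)⟨B(x'−x), x'−x⟩ for all x' ∈ E; (3) u is continuously differentiable and ⟨A(x'−x), x'−x⟩ ≤ ⟨∇u(x') − ∇u(x), x'−x⟩ ≤ ⟨B(x'−x), x'−x⟩ for all x, x' ∈ E. Moreover, when these hold, the gradient ∇u is Lipschitz with constant max(‖A‖, ‖B‖), where ‖A‖, ‖B‖ denote operator norms. -/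
open Set
open scoped RealInnerProductSpace

/-- A convex function on a finite-dimensional space has a subgradient at every point. -/
theorem ConvexOn.exists_subgradient {E : Type*} [NormedAddCommGroup E] [NormedSpace ℝ E]
    [FiniteDimensional ℝ E] {f : E → ℝ} (hf : ConvexOn ℝ univ f) (x : E) :
    ∃ l : StrongDual ℝ E, ∀ x', f x + l (x' - x) ≤ f x' := by
  have hcont : Continuous f := hf.locallyLipschitz.continuous
  have hopen : IsOpen {p : E × ℝ | p.1 ∈ univ ∧ f p.1 < p.2} := by
    simpa using isOpen_lt (hcont.comp continuous_fst) continuous_snd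
  obtain ⟨g, hg⟩ := geometric_hahn_banach_point_open (x := (x, f x))
    hf.convex_strict_epigraph hopen (by simp)
  have key : ∀ z r, g (z, r) = g (z, 0) + r * g (0, 1) := fun z r => by
    rw [← smul_eq_mul, ← map_smul, ← map_add]
    simp
  have hpos : 0 < g (0, 1) := by
    have := hg (x, f x + 1) (by simp)
    rw [key x (f x), key x (f x + 1)] at this
    linarith
  have hle : ∀ x', g (x, 0) + f x * g (0, 1) ≤ g (x', 0) + f x' * g (0, 1) := fun x' => by
    refine le_of_forall_pos_lt_add fun ε hε => ?_
    have := hg (x', f x' + ε / g (0, 1)) (by simp; positivity)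
    rw [key x (f x), key x', add_mul, div_mul_cancel₀ _ hpos.ne'] at this
    linarith
  refine ⟨-(g (0, 1))⁻¹ • g.comp (ContinuousLinearMap.inl ℝ E ℝ), fun x' => ?_⟩
  have hsub : g (x' - x, 0) = g (x', 0) - g (x, 0) := by
    rw [← map_sub]
    simp
  have := hle x'
  simp only [smul_apply, ContinuousLinearMap.comp_apply,
    ContinuousLinearMap.inl_apply, smul_eq_mul, hsub]
  rw [← mul_le_mul_iff_of_pos_right hpos]
  field_simp
  linarith

/-- A function with a subgradient at every point is convex. -/
theorem convexOn_univ_of_exists_subgradient {E : Type*} [AddCommGroup E] [Module ℝ E]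
    {f : E → ℝ} (h : ∀ x, ∃ l : E →ₗ[ℝ] ℝ, ∀ x', f x + l (x' - x) ≤ f x') :
    ConvexOn ℝ univ f := by
  refine ⟨convex_univ, fun x _ z _ a b ha hb hab => ?_⟩
  obtain ⟨l, hl⟩ := h (a • x + b • z)
  have hx := mul_le_mul_of_nonneg_left (hl x) ha
  have hz := mul_le_mul_of_nonneg_left (hl z) hb
  simp only [map_sub, map_add, map_smul, smul_eq_mul] at hx hz ⊢
  obtain rfl : b = 1 - a := by linarith
  linarith

section InnerProduct

variable {E : Type*} [NormedAddCommGroup E] [InnerProductSpace ℝ E]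

theorem inner_map_self_eq_add_sub {A : E →L[ℝ] E} (hA : ∀ x y : E, ⟪A x, y⟫ = ⟪x, A y⟫)
    (x x' : E) :
    ⟪A x', x'⟫ = ⟪A x, x⟫ + 2 * ⟪A x, x' - x⟫ + ⟪A (x' - x), x' - x⟫ := by
  have h := hA x' x
  rw [real_inner_comm] at h
  simp only [map_sub, inner_sub_left, inner_sub_right]
  rw [hA x' x, real_inner_comm (A x) x']
  ring

theorem convexOn_sub_quadratic_iff [FiniteDimensional ℝ E] {A : E →L[ℝ] E}
    (hA : ∀ x y : E, ⟪A x, y⟫ = ⟪x, A y⟫) {u : E → ℝ} :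
    ConvexOn ℝ univ (fun x => u x - (1 / 2) * ⟪A x, x⟫) ↔
      ∀ x, ∃ y, ∀ x', (1 / 2) * ⟪A (x' - x), x' - x⟫ ≤ u x' - u x - ⟪y, x' - x⟫ := by
  constructor
  · intro h x
    obtain ⟨l, hl⟩ := h.exists_subgradient x
    refine ⟨(InnerProductSpace.toDual ℝ E).symm l + A x, fun x' => ?_⟩
    have := hl x'
    rw [inner_add_left, InnerProductSpace.toDual_symm_apply]
    rw [inner_map_self_eq_add_sub hA x x'] at this
    linarith
  · refine fun h => convexOn_univ_of_exists_subgradient fun x => ?_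
    obtain ⟨y, hy⟩ := h x
    refine ⟨(innerSL ℝ (y - A x)).toLinearMap, fun x' => ?_⟩
    have := hy x'
    simp only [ContinuousLinearMap.coe_coe, innerSL_apply_apply, inner_sub_left y]
    rw [inner_map_self_eq_add_sub hA x x']
    linarith

theorem concaveOn_sub_quadratic_iff [FiniteDimensional ℝ E] {B : E →L[ℝ] E}
    (hB : ∀ x y : E, ⟪B x, y⟫ = ⟪x, B y⟫) {u : E → ℝ} :
    ConcaveOn ℝ univ (fun x => u x - (1 / 2) * ⟪B x, x⟫) ↔
      ∀ x, ∃ y, ∀ x', u x' - u x - ⟪y, x' - x⟫ ≤ (1 / 2) * ⟪B (x' - x), x' - x⟫ := by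
  have h := convexOn_sub_quadratic_iff (A := -B) (u := -u) (fun x y => by simp [hB])
  rw [← neg_convexOn_iff]
  convert! h using 1
  · congr! 2
    simp
    ring
  · refine forall_congr' fun x => (Equiv.neg E).exists_congr fun y => forall_congr' fun x' => ?_
    simp only [Equiv.neg_apply, Pi.neg_apply, neg_apply, inner_neg_left]
    constructor <;> intro h <;> linarith

/-- A linear functional bounded above by a quadratic form vanishes. -/
theorem eq_zero_of_inner_le_quadratic {C : E →L[ℝ] E} {v : E}
    (h : ∀ w, ⟪v, w⟫ ≤ ⟪C w, w⟫) : v = 0 := by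
  by_contra hv
  have hv' : 0 < ⟪v, v⟫ := real_inner_self_pos.2 hv
  have key : ∀ t : ℝ, t * ⟪v, v⟫ ≤ t ^ 2 * ⟪C v, v⟫ := fun t => by
    have := h (t • v)
    simp only [map_smul, inner_smul_left, inner_smul_right, RCLike.conj_to_real] at this
    linarith
  set c := ⟪C v, v⟫
  set d := ⟪v, v⟫
  have h1 := key (d / (2 * (|c| + 1)))
  have hc : 0 < |c| + 1 := by positivity
  have h2 := le_abs_self c
  rw [div_pow, div_mul_eq_mul_div, div_mul_eq_mul_div, div_le_div_iff₀ (by positivity)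
    (by positivity)] at h1
  have h3 : 0 < d ^ 2 * (2 * (|c| + 1)) := by positivity
  nlinarith

/-- The first-order Taylor remainder of `u`, with `y` in the role of the gradient of `u`, is
bounded above and below by the quadratic forms of `A` and `B`. -/
def IsQuadraticPinched (A B : E →L[ℝ] E) (u : E → ℝ) (y : E → E) : Prop :=
  ∀ x x', (1 / 2) * ⟪A (x' - x), x' - x⟫ ≤ u x' - u x - ⟪y x, x' - x⟫ ∧
    u x' - u x - ⟪y x, x' - x⟫ ≤ (1 / 2) * ⟪B (x' - x), x' - x⟫

namespace IsQuadraticPinched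

variable {A B : E →L[ℝ] E} {u : E → ℝ} {y : E → E}

theorem abs_le (h : IsQuadraticPinched A B u y) (x x' : E) :
    |u x' - u x - ⟪y x, x' - x⟫| ≤ max ‖A‖ ‖B‖ / 2 * ‖x' - x‖ ^ 2 := by
  have bound : ∀ C : E →L[ℝ] E, ‖C‖ ≤ max ‖A‖ ‖B‖ →
      |⟪C (x' - x), x' - x⟫| ≤ max ‖A‖ ‖B‖ * ‖x' - x‖ ^ 2 := fun C hC =>
    calc |⟪C (x' - x), x' - x⟫| ≤ ‖C (x' - x)‖ * ‖x' - x‖ := abs_real_inner_le_norm _ _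
      _ ≤ (max ‖A‖ ‖B‖ * ‖x' - x‖) * ‖x' - x‖ := by gcongr; exact C.le_of_opNorm_le hC _
      _ = _ := by ring
  have hA := _root_.abs_le.1 (bound A (le_max_left _ _))
  have hB := _root_.abs_le.1 (bound B (le_max_right _ _))
  have := h x x'
  exact _root_.abs_le.2 ⟨by linarith, by linarith⟩

theorem norm_sub_le (h : IsQuadraticPinched A B u y) (x x' : E) :
    ‖y x' - y x‖ ≤ max ‖A‖ ‖B‖ * ‖x' - x‖ := by
  have habs := h.abs_le
  set L := max ‖A‖ ‖B‖
  have hL : 0 ≤ L := (norm_nonneg A).trans (le_max_left _ _)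
  have key : ∀ v, 2 * ⟪y x' - y x, v⟫ ≤ L * (2 * ‖v‖ ^ 2 + ‖x' - x‖ ^ 2 / 2) := fun v => by
    obtain ⟨m, d, rfl, rfl⟩ : ∃ m d, x = m - d ∧ x' = m + d :=
      ⟨(1 / 2 : ℝ) • (x + x'), (1 / 2 : ℝ) • (x' - x), by module, by module⟩
    have h1 := (_root_.abs_le.1 (habs (m - d) (m + v))).2
    have h2 := (_root_.abs_le.1 (habs (m + d) (m + v))).1
    have h3 := (_root_.abs_le.1 (habs (m + d) (m - v))).2
    have h4 := (_root_.abs_le.1 (habs (m - d) (m - v))).1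
    rw [show m + v - (m - d) = v + d by abel] at h1
    rw [show m + v - (m + d) = v - d by abel] at h2
    rw [show m - v - (m + d) = -(v + d) by abel] at h3
    rw [show m - v - (m - d) = -(v - d) by abel] at h4
    rw [show m + d - (m - d) = (2 : ℝ) • d by module, norm_smul]
    have hp := parallelogram_law_with_norm ℝ v d
    simp only [norm_neg, inner_neg_right, inner_add_right, inner_sub_right, inner_sub_left,
      Real.norm_ofNat] at *
    linear_combination h1 + h2 + h3 + h4 + L * hp
  rcases hL.eq_or_lt with h0 | hpos
  · have := key (y x' - y x)
    rw [← h0, real_inner_self_eq_norm_sq] at this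
    have hz : ‖y x' - y x‖ = 0 := by nlinarith [sq_nonneg ‖y x' - y x‖]
    simp [hz, ← h0]
  · have := key ((1 / (2 * L)) • (y x' - y x))
    rw [inner_smul_right, real_inner_self_eq_norm_sq, norm_smul, Real.norm_of_nonneg
      (by positivity)] at this
    field_simp at this
    refine abs_le_of_sq_le_sq' ?_ (by positivity) |>.2
    linarith

theorem hasGradientAt [CompleteSpace E] (h : IsQuadraticPinched A B u y) (x : E) :
    HasGradientAt u (y x) x := by
  rw [hasGradientAt_iff_isLittleO]
  refine Asymptotics.IsBigO.trans_isLittleO (g := fun x' => ‖x' - x‖ ^ 2)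
    (.of_bound (max ‖A‖ ‖B‖ / 2) (.of_forall fun x' => ?_)) ?_
  · simpa using h.abs_le x x'
  · exact (Asymptotics.isLittleO_norm_pow_id (one_lt_two)).comp_tendsto
      (tendsto_sub_nhds_zero_iff.2 Filter.tendsto_id)

theorem gradient_eq [CompleteSpace E] (h : IsQuadraticPinched A B u y) : gradient u = y :=
  funext fun x => (h.hasGradientAt x).gradient

theorem contDiff [CompleteSpace E] (h : IsQuadraticPinched A B u y) : ContDiff ℝ 1 u := by
  refine contDiff_one_iff_hasFDerivAt.2
    ⟨_, ?_, fun x => hasGradientAt_iff_hasFDerivAt.1 (h.hasGradientAt x)⟩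
  refine (InnerProductSpace.toDual ℝ E).continuous.comp ?_
  refine (LipschitzWith.of_dist_le_mul (K := (max ‖A‖ ‖B‖).toNNReal) fun x x' => ?_).continuous
  rw [Real.coe_toNNReal _ ((norm_nonneg A).trans (le_max_left _ _)), dist_eq_norm, dist_eq_norm]
  exact h.norm_sub_le x' x

theorem inner_sub_bounds (h : IsQuadraticPinched A B u y) (x x' : E) :
    ⟪A (x' - x), x' - x⟫ ≤ ⟪y x' - y x, x' - x⟫ ∧
      ⟪y x' - y x, x' - x⟫ ≤ ⟪B (x' - x), x' - x⟫ := by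
  have h1 := h x x'
  have h2 := h x' x
  rw [← neg_sub x' x] at h2
  simp only [map_neg, inner_neg_left, inner_neg_right, neg_neg, inner_sub_left _ _ (x' - x)] at *
  constructor <;> linarith

end IsQuadraticPinched

theorem quadratic_le_of_le_inner_gradient_sub [CompleteSpace E] {A : E →L[ℝ] E} {u : E → ℝ}
    {y : E → E} (hu : ∀ x, HasGradientAt u (y x) x)
    (h : ∀ x x' : E, ⟪A (x' - x), x' - x⟫ ≤ ⟪y x' - y x, x' - x⟫) (x x' : E) :
    (1 / 2) * ⟪A (x' - x), x' - x⟫ ≤ u x' - u x - ⟪y x, x' - x⟫ := by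
  obtain ⟨d, rfl⟩ : ∃ d, x' = x + d := ⟨x' - x, by abel⟩
  simp only [add_sub_cancel_left]
  let φ : ℝ → ℝ := fun t => u (x + t • d) - t * ⟪y x, d⟫ - t ^ 2 * ((1 / 2) * ⟪A d, d⟫)
  have hφ : ∀ t, HasDerivAt φ (⟪y (x + t • d), d⟫ - ⟪y x, d⟫ - t * ⟪A d, d⟫) t := fun t => by
    have hline : HasDerivAt (fun t : ℝ => x + t • d) d t := by
      simpa using ((hasDerivAt_id t).smul_const d).const_add x
    have h1 := (hasGradientAt_iff_hasFDerivAt.1 (hu (x + t • d))).comp_hasDerivAt t hline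
    rw [InnerProductSpace.toDual_apply_apply] at h1
    have h2 := ((hasDerivAt_id t).mul_const ⟪y x, d⟫)
    have h3 := ((hasDerivAt_pow 2 t).mul_const ((1 / 2) * ⟪A d, d⟫))
    convert! (h1.sub h2).sub h3 using 1
    simp
    ring
  have hmono : MonotoneOn φ (Ici 0) := by
    refine monotoneOn_of_deriv_nonneg (convex_Ici 0)
      (fun t _ => (hφ t).continuousAt.continuousWithinAt)
      (fun t _ => (hφ t).differentiableAt.differentiableWithinAt) fun t ht => ?_
    rw [interior_Ici, mem_Ioi] at ht
    rw [(hφ t).deriv]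
    have := h x (x + t • d)
    simp only [add_sub_cancel_left, map_smul, inner_smul_left, inner_smul_right,
      RCLike.conj_to_real, inner_sub_left] at this
    have := le_of_mul_le_mul_left this ht
    linarith
  have := hmono (mem_Ici.2 le_rfl) (mem_Ici.2 zero_le_one) zero_le_one
  simp only [φ, zero_smul, one_smul, add_zero] at this
  linarith

theorem exists_isQuadraticPinched [FiniteDimensional ℝ E] {A B : E →L[ℝ] E}
    (hA : ∀ x y : E, ⟪A x, y⟫ = ⟪x, A y⟫) (hB : ∀ x y : E, ⟪B x, y⟫ = ⟪x, B y⟫) {u : E → ℝ}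
    (hconv : ConvexOn ℝ univ (fun x => u x - (1 / 2) * ⟪A x, x⟫))
    (hconc : ConcaveOn ℝ univ (fun x => u x - (1 / 2) * ⟪B x, x⟫)) :
    ∃ y, IsQuadraticPinched A B u y := by
  choose y hy using (convexOn_sub_quadratic_iff hA).1 hconv
  choose z hz using (concaveOn_sub_quadratic_iff hB).1 hconc
  have hyz : y = z := funext fun x => sub_eq_zero.1 <|
    eq_zero_of_inner_le_quadratic (C := (1 / 2 : ℝ) • (B - A)) fun w => by
      have h1 := hy x (x + w)
      have h2 := hz x (x + w)
      simp only [add_sub_cancel_left] at h1 h2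
      simp only [inner_sub_left, smul_apply, sub_apply,
        inner_smul_left, RCLike.conj_to_real]
      linarith
  exact ⟨y, fun x x' => ⟨hy x x', hyz ▸ hz x x'⟩⟩

end InnerProduct

/-- characterization of two-sided Hessian bounds `A ≤ Hu ≤ B` for a function
`u` on a finite-dimensional real inner product space, and the Lipschitz bound on the
gradient. -/
theorem stmt0 {E : Type*} [NormedAddCommGroup E] [InnerProductSpace ℝ E]
    [FiniteDimensional ℝ E]
    (A B : E →L[ℝ] E)
    (hA : ∀ x y : E, ⟪A x, y⟫ = ⟪x, A y⟫)
    (hB : ∀ x y : E, ⟪B x, y⟫ = ⟪x, B y⟫)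
    (u : E → ℝ) :
    ((ConvexOn ℝ univ (fun x => u x - (1 / 2) * ⟪A x, x⟫) ∧
        ConcaveOn ℝ univ (fun x => u x - (1 / 2) * ⟪B x, x⟫)) ↔
      (∀ x : E, ∃ y : E, ∀ x' : E,
        (1 / 2) * ⟪A (x' - x), x' - x⟫ ≤ u x' - u x - ⟪y, x' - x⟫ ∧
          u x' - u x - ⟪y, x' - x⟫ ≤ (1 / 2) * ⟪B (x' - x), x' - x⟫)) ∧
    ((ConvexOn ℝ univ (fun x => u x - (1 / 2) * ⟪A x, x⟫) ∧
        ConcaveOn ℝ univ (fun x => u x - (1 / 2) * ⟪B x, x⟫)) ↔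
      (ContDiff ℝ 1 u ∧ ∀ x x' : E,
        ⟪A (x' - x), x' - x⟫ ≤ ⟪gradient u x' - gradient u x, x' - x⟫ ∧
          ⟪gradient u x' - gradient u x, x' - x⟫ ≤ ⟪B (x' - x), x' - x⟫)) ∧
    ((ConvexOn ℝ univ (fun x => u x - (1 / 2) * ⟪A x, x⟫) ∧
        ConcaveOn ℝ univ (fun x => u x - (1 / 2) * ⟪B x, x⟫)) →
      ∀ x x' : E, ‖gradient u x' - gradient u x‖ ≤ max ‖A‖ ‖B‖ * ‖x' - x‖) := by
  have of_taylor : (∀ x : E, ∃ y : E, ∀ x' : E,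
        (1 / 2) * ⟪A (x' - x), x' - x⟫ ≤ u x' - u x - ⟪y, x' - x⟫ ∧
          u x' - u x - ⟪y, x' - x⟫ ≤ (1 / 2) * ⟪B (x' - x), x' - x⟫) →
      ConvexOn ℝ univ (fun x => u x - (1 / 2) * ⟪A x, x⟫) ∧
        ConcaveOn ℝ univ (fun x => u x - (1 / 2) * ⟪B x, x⟫) := fun h =>
    ⟨(convexOn_sub_quadratic_iff hA).2 fun x => (h x).imp fun _ hy x' => (hy x').1,
      (concaveOn_sub_quadratic_iff hB).2 fun x => (h x).imp fun _ hy x' => (hy x').2⟩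
  refine ⟨⟨fun h => ?_, of_taylor⟩, ⟨fun h => ?_, fun h => of_taylor fun x => ?_⟩, fun h => ?_⟩
  · obtain ⟨y, hy⟩ := exists_isQuadraticPinched hA hB h.1 h.2
    exact fun x => ⟨y x, hy x⟩
  · obtain ⟨y, hy⟩ := exists_isQuadraticPinched hA hB h.1 h.2
    exact ⟨hy.contDiff, hy.gradient_eq ▸ hy.inner_sub_bounds⟩
  · have hu : ∀ x, HasGradientAt u (gradient u x) x := fun x =>
      (h.1.differentiable one_ne_zero x).hasGradientAt
    have hneg : ∀ x, HasGradientAt (-u) (-gradient u x) x := fun x => by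
      rw [hasGradientAt_iff_hasFDerivAt, map_neg]
      exact (hasGradientAt_iff_hasFDerivAt.1 (hu x)).neg
    refine ⟨gradient u x, fun x' =>
      ⟨quadratic_le_of_le_inner_gradient_sub hu (fun x x' => (h.2 x x').1) x x', ?_⟩⟩
    have := quadratic_le_of_le_inner_gradient_sub (A := -B) hneg (fun x x' => by
      have := (h.2 x x').2
      rw [neg_apply, ← neg_sub', inner_neg_left, inner_neg_left]
      linarith) x x'
    simp only [Pi.neg_apply, neg_apply, inner_neg_left] at this
    linarith
  · obtain ⟨y, hy⟩ := exists_isQuadraticPinched hA hB h.1 h.2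
    exact hy.gradient_eq ▸ hy.norm_sub_le
end

section
/- Let E be a finite-dimensional real inner product space of dimension d, let 0 < c ≤ C, and let V : E → ℝ satisfy c ≤ HV ≤ C. Then e^{−V} is integrable on E (so the Gibbs measure μ = Z^{−1} e^{−V(x)} dx is well-defined), V is continuously differentiable, ∇V is μ-integrable with ∫_E ∇V dμ = 0, and, writing x̄ = ∫_E x dμ(x) for the mean of μ, one has d/C ≤ ∫_E ‖x − x̄‖² dμ(x) ≤ d/c. -/
open Set MeasureTheory

section Subgradient

variable {E : Type*} [NormedAddCommGroup E] [InnerProductSpace ℝ E]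

/-- A continuous convex function on a Hilbert space has a subgradient at every point. -/
theorem ConvexOn.exists_inner_le [CompleteSpace E] {f : E → ℝ} (hf : ConvexOn ℝ univ f)
    (hcont : Continuous f) (x : E) : ∃ p : E, ∀ y, f x + inner ℝ p (y - x) ≤ f y := by
  have hopen : IsOpen {p : E × ℝ | p.1 ∈ univ ∧ f p.1 < p.2} := by
    simp only [mem_univ, true_and]
    exact isOpen_lt (by fun_prop) (by fun_prop)
  obtain ⟨L, hL⟩ := geometric_hahn_banach_point_open hf.convex_strict_epigraph hopen
    (show (x, f x) ∉ _ by simp)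
  set u : E →L[ℝ] ℝ := L.comp (.inl ℝ E ℝ) with hu
  set s : ℝ := L (0, 1) with hs
  have hdecomp (y : E) (t : ℝ) : L (y, t) = u y + t * s := by
    have : ((y, t) : E × ℝ) = (y, 0) + t • (0, 1) := by simp
    rw [this, map_add, map_smul]
    simp [hu, hs]
  have hlt (y : E) (t : ℝ) (h : f y < t) : u x + f x * s < u y + t * s := by
    simpa only [hdecomp] using hL (y, t) ⟨mem_univ _, h⟩
  have hspos : 0 < s := by linarith [hlt x (f x + 1) (by linarith)]
  have hle (y : E) : u x + f x * s ≤ u y + f y * s := by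
    refine le_of_forall_pos_lt_add fun ε hε => ?_
    have := hlt y (f y + ε / s) (by linarith [div_pos hε hspos])
    rwa [add_mul, div_mul_cancel₀ _ hspos.ne', ← add_assoc] at this
  refine ⟨(InnerProductSpace.toDual ℝ E).symm (-s⁻¹ • u), fun y => ?_⟩
  rw [InnerProductSpace.toDual_symm_apply]
  simp only [FunLike.coe_smul, Pi.smul_apply, map_sub, smul_eq_mul]
  have h := mul_le_mul_of_nonneg_left (hle y) (inv_nonneg.2 hspos.le)
  have h1 (t : ℝ) : s⁻¹ * (t * s) = t := by field_simp
  rw [mul_add, mul_add, h1, h1] at h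
  linarith

end Subgradient

section HessianBounds

variable {E : Type*} [NormedAddCommGroup E] [InnerProductSpace ℝ E] {c C : ℝ} {V : E → ℝ}

theorem norm_sq_eq_add_inner_sub (x y : E) :
    ‖y‖ ^ 2 = ‖x‖ ^ 2 + 2 * inner ℝ x (y - x) + ‖y - x‖ ^ 2 := by
  simpa using norm_add_sq_real x (y - x)

theorem eq_of_forall_inner_le_mul_norm_sq {p q : E} {K : ℝ}
    (h : ∀ w, inner ℝ p w ≤ inner ℝ q w + K * ‖w‖ ^ 2) : p = q := by
  rw [← sub_eq_zero, ← norm_eq_zero]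
  by_contra hne
  have hpos : 0 < ‖p - q‖ ^ 2 := by positivity
  have ht (t : ℝ) (ht : 0 < t) : 1 ≤ t * K := by
    have := h (t • (p - q))
    have h2 : inner ℝ p (t • (p - q)) - inner ℝ q (t • (p - q)) = t * ‖p - q‖ ^ 2 := by
      rw [← inner_sub_left, inner_smul_right, real_inner_self_eq_norm_sq]
    rw [norm_smul, mul_pow, Real.norm_eq_abs, sq_abs] at this
    have h3 : t * ‖p - q‖ ^ 2 * 1 ≤ t * ‖p - q‖ ^ 2 * (t * K) := by linarith
    exact le_of_mul_le_mul_left h3 (by positivity)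
  have h1 := ht (1 / (2 * (|K| + 1))) (by positivity)
  have h2 : 1 / (2 * (|K| + 1)) * K ≤ 1 / 2 := by
    rw [div_mul_eq_mul_div, one_mul, div_le_iff₀ (by positivity)]
    linarith [le_abs_self K]
  linarith

/-- Quadratic Taylor bounds at every point for a function with `c ≤ HV ≤ C`. -/
theorem exists_quadratic_bounds [FiniteDimensional ℝ E]
    (hconv : ConvexOn ℝ univ (fun x => V x - c / 2 * ‖x‖ ^ 2))
    (hconc : ConcaveOn ℝ univ (fun x => V x - C / 2 * ‖x‖ ^ 2)) (x : E) :
    ∃ g : E, ∀ y, V x + inner ℝ g (y - x) + c / 2 * ‖y - x‖ ^ 2 ≤ V y ∧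
      V y ≤ V x + inner ℝ g (y - x) + C / 2 * ‖y - x‖ ^ 2 := by
  obtain ⟨p, hp⟩ := hconv.exists_inner_le
    (continuousOn_univ.1 (hconv.continuousOn isOpen_univ)) x
  obtain ⟨q, hq⟩ := hconc.neg.exists_inner_le
    (continuousOn_univ.1 (hconc.neg.continuousOn isOpen_univ)) x
  have hp' (y : E) : V x + inner ℝ (p + c • x) (y - x) + c / 2 * ‖y - x‖ ^ 2 ≤ V y := by
    have := hp y
    rw [norm_sq_eq_add_inner_sub x y] at this
    rw [inner_add_left, real_inner_smul_left]
    linarith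
  have hq' (y : E) : V y ≤ V x + inner ℝ (-q + C • x) (y - x) + C / 2 * ‖y - x‖ ^ 2 := by
    have := hq y
    simp only [Pi.neg_apply] at this
    rw [norm_sq_eq_add_inner_sub x y] at this
    rw [inner_add_left, real_inner_smul_left, inner_neg_left]
    linarith
  have heq : p + c • x = -q + C • x := by
    refine eq_of_forall_inner_le_mul_norm_sq (K := C / 2 - c / 2) fun w => ?_
    have h1 := hp' (x + w)
    have h2 := hq' (x + w)
    rw [add_sub_cancel_left] at h1 h2
    linarith
  exact ⟨p + c • x, fun y => ⟨hp' y, heq ▸ hq' y⟩⟩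

theorem hasGradientAt_of_quadratic_bounds [CompleteSpace E] {x g : E}
    (h : ∀ y, V x + inner ℝ g (y - x) + c / 2 * ‖y - x‖ ^ 2 ≤ V y ∧
      V y ≤ V x + inner ℝ g (y - x) + C / 2 * ‖y - x‖ ^ 2) : HasGradientAt V g x := by
  rw [hasGradientAt_iff_isLittleO]
  have hO : (fun y => V y - V x - inner ℝ g (y - x)) =O[nhds x] fun y => ‖y - x‖ ^ 2 := by
    refine Asymptotics.IsBigO.of_bound (|c / 2| + |C / 2|) (Filter.Eventually.of_forall fun y => ?_)
    obtain ⟨h1, h2⟩ := h y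
    have hn : 0 ≤ ‖y - x‖ ^ 2 := by positivity
    rw [Real.norm_eq_abs, Real.norm_of_nonneg hn, abs_le]
    constructor
    · nlinarith [neg_abs_le (c / 2), abs_nonneg (C / 2)]
    · nlinarith [le_abs_self (C / 2), abs_nonneg (c / 2)]
  refine hO.trans_isLittleO ?_
  have h0 : Filter.Tendsto (fun y => y - x) (nhds x) (nhds 0) :=
    tendsto_sub_nhds_zero_iff.2 Filter.tendsto_id
  exact (Asymptotics.isLittleO_norm_pow_id one_lt_two).comp_tendsto h0

theorem lipschitz_of_quadratic_bounds {g : E → E} (hc : 0 < c) (hcC : c ≤ C)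
    (h : ∀ x y, V x + inner ℝ (g x) (y - x) + c / 2 * ‖y - x‖ ^ 2 ≤ V y ∧
      V y ≤ V x + inner ℝ (g x) (y - x) + C / 2 * ‖y - x‖ ^ 2) (x y : E) :
    ‖g y - g x‖ ≤ 2 * C * ‖y - x‖ := by
  have hC : 0 < C := hc.trans_le hcC
  set D := g y - g x with hD
  set t : ℝ := 1 / (2 * C) with ht
  set z := y + t • D with hz
  have h1 := (h y z).1
  have h2 := (h x z).2
  have h3 := (h x y).1
  have e1 : z - y = t • D := by simp [hz]
  have e2 : z - x = (y - x) + t • D := by rw [hz]; abel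
  have e3 : inner ℝ (g y) (t • D) - inner ℝ (g x) (t • D) = t * ‖D‖ ^ 2 := by
    rw [← inner_sub_left, ← hD, inner_smul_right, real_inner_self_eq_norm_sq]
  rw [e1] at h1
  rw [e2, inner_add_right] at h2
  have h4 : ‖(y - x) + t • D‖ ^ 2 ≤ 2 * (‖y - x‖ ^ 2 + t ^ 2 * ‖D‖ ^ 2) := by
    have := parallelogram_law_with_norm ℝ (y - x) (t • D)
    have e : ‖t • D‖ * ‖t • D‖ = t ^ 2 * ‖D‖ ^ 2 := by
      rw [norm_smul, Real.norm_eq_abs, ← sq_abs t]; ring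
    nlinarith [sq_nonneg ‖(y - x) - t • D‖]
  have h5 : 0 ≤ c / 2 * ‖y - x‖ ^ 2 := by positivity
  have h6 : 0 ≤ c / 2 * ‖t • D‖ ^ 2 := by positivity
  have h7 : t * ‖D‖ ^ 2 ≤ C * (‖y - x‖ ^ 2 + t ^ 2 * ‖D‖ ^ 2) := by nlinarith
  have h8 : ‖D‖ ^ 2 ≤ (2 * C * ‖y - x‖) ^ 2 := by
    have e4 : C * (t ^ 2 * ‖D‖ ^ 2) = t * ‖D‖ ^ 2 / 2 := by rw [ht]; field_simp
    have e5 : ‖D‖ ^ 2 = 2 * C * (t * ‖D‖ ^ 2) := by rw [ht]; field_simp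
    have : t * ‖D‖ ^ 2 ≤ 2 * C * ‖y - x‖ ^ 2 := by linarith
    calc ‖D‖ ^ 2 = 2 * C * (t * ‖D‖ ^ 2) := e5
      _ ≤ 2 * C * (2 * C * ‖y - x‖ ^ 2) := by gcongr
      _ = _ := by ring
  exact (sq_le_sq₀ (norm_nonneg _) (by positivity)).1 h8

/-- Strong monotonicity and one-sided Lipschitz bound for the gradient. -/
theorem inner_sub_bounds_of_quadratic_bounds {g : E → E}
    (h : ∀ x y, V x + inner ℝ (g x) (y - x) + c / 2 * ‖y - x‖ ^ 2 ≤ V y ∧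
      V y ≤ V x + inner ℝ (g x) (y - x) + C / 2 * ‖y - x‖ ^ 2) (x y : E) :
    c * ‖y - x‖ ^ 2 ≤ inner ℝ (g y - g x) (y - x) ∧
      inner ℝ (g y - g x) (y - x) ≤ C * ‖y - x‖ ^ 2 := by
  obtain ⟨h1, h2⟩ := h x y
  obtain ⟨h3, h4⟩ := h y x
  rw [← neg_sub y x, inner_neg_right, norm_neg] at h3 h4
  rw [inner_sub_left]
  constructor <;> linarith

end HessianBounds

section Integrability

variable {E : Type*} [NormedAddCommGroup E] [InnerProductSpace ℝ E] [FiniteDimensional ℝ E]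
  [MeasurableSpace E] [BorelSpace E] {c : ℝ} {V : E → ℝ}

theorem integrable_exp_neg_mul_norm_sq {b : ℝ} (hb : 0 < b) :
    Integrable (fun x : E => Real.exp (-b * ‖x‖ ^ 2)) := by
  refine Integrable.of_integral_ne_zero ?_
  rw [GaussianFourier.integral_rexp_neg_mul_sq_norm hb]
  positivity

/-- Functions of at most quadratic growth are integrable against `e^{-V}` when `V` grows at least
quadratically. -/
theorem integrable_exp_neg_smul (hc : 0 < c) (hV : Continuous V) {g : E}
    (hg : ∀ x, V 0 + inner ℝ g x + c / 2 * ‖x‖ ^ 2 ≤ V x) {f : E → ℝ} (hf : Continuous f) {K : ℝ}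
    (hK : ∀ x, ‖f x‖ ≤ K * (1 + ‖x‖) ^ 2) :
    Integrable (fun x => Real.exp (-V x) • f x) := by
  refine ((integrable_exp_neg_mul_norm_sq (E := E) (b := c / 4) (by positivity)).const_mul
    (K * Real.exp (-V 0 + (2 + ‖g‖) ^ 2 / c))).mono'
    (by fun_prop : Continuous _).aestronglyMeasurable (Filter.Eventually.of_forall fun x => ?_)
  have hK0 : 0 ≤ K := by simpa using (norm_nonneg _).trans (hK 0)
  set r := ‖x‖ with hr
  have hr0 : 0 ≤ r := norm_nonneg x
  have h1 : (1 + r) ^ 2 ≤ Real.exp (2 * r) := by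
    rw [two_mul, Real.exp_add, ← sq]
    gcongr
    linarith [Real.add_one_le_exp r]
  have h2 : -(‖g‖ * r) ≤ inner ℝ g x := by
    linarith [neg_abs_le (inner ℝ g x), abs_real_inner_le_norm g x]
  have h3 : (2 + ‖g‖) * r ≤ (2 + ‖g‖) ^ 2 / c + c / 4 * r ^ 2 := by
    have : (2 + ‖g‖) ^ 2 / c + c / 4 * r ^ 2 - (2 + ‖g‖) * r
        = (2 + ‖g‖ - c * r / 2) ^ 2 / c := by field_simp; ring
    have : 0 ≤ (2 + ‖g‖ - c * r / 2) ^ 2 / c := by positivity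
    linarith
  rw [norm_smul, Real.norm_of_nonneg (Real.exp_pos _).le]
  calc Real.exp (-V x) * ‖f x‖
      ≤ Real.exp (-V x) * (K * Real.exp (2 * r)) := by
        gcongr
        exact (hK x).trans (by gcongr)
    _ = K * Real.exp (-V x + 2 * r) := by rw [Real.exp_add]; ring
    _ ≤ K * Real.exp (-V 0 + (2 + ‖g‖) ^ 2 / c + -(c / 4) * r ^ 2) := by
        gcongr K * Real.exp ?_
        linarith [hg x]
    _ = _ := by rw [Real.exp_add _ (-(c / 4) * r ^ 2)]; ring

/-- Integration by parts against `e^{-V}`. -/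
theorem integral_exp_neg_mul_fderiv {G : E → E} (hG : ∀ x, HasGradientAt V (G x) x)
    {h : E → ℝ} (hh : Differentiable ℝ h) (v : E)
    (i1 : Integrable (fun x => Real.exp (-V x) • h x))
    (i2 : Integrable (fun x => Real.exp (-V x) • fderiv ℝ h x v))
    (i3 : Integrable (fun x => Real.exp (-V x) • (inner ℝ (G x) v * h x))) :
    ∫ x, Real.exp (-V x) • fderiv ℝ h x v
      = ∫ x, Real.exp (-V x) • (inner ℝ (G x) v * h x) := by
  have hd (x : E) : HasFDerivAt (fun x => Real.exp (-V x))
      (Real.exp (-V x) • -(InnerProductSpace.toDual ℝ E (G x))) x :=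
    (hG x).hasFDerivAt.neg.exp
  have he (x : E) : fderiv ℝ (fun x => Real.exp (-V x)) x v * h x
      = -(Real.exp (-V x) • (inner ℝ (G x) v * h x)) := by
    rw [(hd x).fderiv]
    simp [mul_assoc]
  have := integral_mul_fderiv_eq_neg_fderiv_mul_of_integrable (μ := (volume : Measure E))
    (f := fun x => Real.exp (-V x)) (g := h) (v := v) (by simp only [he]; exact i3.neg) i2 i1
    (fun x _ => (hd x).differentiableAt) (fun x _ => hh x)
  simp only [he, integral_neg, neg_neg] at this
  exact this

end Integrability

/-- for a potential `V` with `c ≤ HV ≤ C` on a `d`-dimensional real inner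
product space, `e^{-V}` is integrable, `V` is `C¹`, the Gibbs measure
`μ = Z⁻¹ e^{-V(x)} dx` satisfies `∫ ∇V dμ = 0`, and the variance of `μ` lies between
`d/C` and `d/c`. -/
theorem stmt2 {E : Type*} [NormedAddCommGroup E] [InnerProductSpace ℝ E]
    [FiniteDimensional ℝ E] [MeasurableSpace E] [BorelSpace E]
    (c C : ℝ) (hc : 0 < c) (hcC : c ≤ C) (V : E → ℝ)
    (hconv : ConvexOn ℝ univ (fun x => V x - c / 2 * ‖x‖ ^ 2))
    (hconc : ConcaveOn ℝ univ (fun x => V x - C / 2 * ‖x‖ ^ 2)) :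
    Integrable (fun x => Real.exp (-V x)) (volume : Measure E) ∧
    ContDiff ℝ 1 V ∧
    ∀ μ : Measure E,
      μ = (volume : Measure E).withDensity
          (fun x => ENNReal.ofReal ((∫ y, Real.exp (-V y))⁻¹ * Real.exp (-V x))) →
      Integrable (fun x => gradient V x) μ ∧
      (∫ x, gradient V x ∂μ) = 0 ∧
      (Module.finrank ℝ E : ℝ) / C ≤ ∫ x, ‖x - ∫ y, y ∂μ‖ ^ 2 ∂μ ∧
      (∫ x, ‖x - ∫ y, y ∂μ‖ ^ 2 ∂μ) ≤ (Module.finrank ℝ E : ℝ) / c := by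
  have hC : 0 < C := hc.trans_le hcC
  choose G hG using exists_quadratic_bounds hconv hconc
  have hgrad (x : E) : HasGradientAt V (G x) x := hasGradientAt_of_quadratic_bounds (hG x)
  have hlip := lipschitz_of_quadratic_bounds hc hcC hG
  have hGcont : Continuous G := by
    refine (LipschitzWith.of_dist_le_mul (K := ⟨2 * C, by positivity⟩) fun x y => ?_).continuous
    rw [dist_eq_norm, dist_eq_norm]
    exact hlip y x
  have hV1 : ContDiff ℝ 1 V := by
    refine contDiff_one_iff_fderiv.2 ⟨fun x => (hgrad x).differentiableAt, ?_⟩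
    have : fderiv ℝ V = fun x => InnerProductSpace.toDual ℝ E (G x) :=
      funext fun x => (hgrad x).hasFDerivAt.fderiv
    rw [this]
    fun_prop
  have hVcont : Continuous V := hV1.continuous
  have hint {f : E → ℝ} (hf : Continuous f) {K : ℝ} (hK : ∀ x, ‖f x‖ ≤ K * (1 + ‖x‖) ^ 2) :
      Integrable (fun x => Real.exp (-V x) • f x) :=
    integrable_exp_neg_smul hc hVcont (fun x => by simpa using (hG 0 x).1) hf hK
  have hexp : Integrable (fun x => Real.exp (-V x)) (volume : Measure E) := by
    simpa using hint (f := fun _ : E => (1 : ℝ)) (K := 1) continuous_const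
      (fun x => by rw [norm_one]; nlinarith [norm_nonneg x])
  refine ⟨hexp, hV1, fun μ hμ => ?_⟩
  have hμt : μ = (volume : Measure E).tilted (fun x => -V x) := by
    rw [hμ, Measure.tilted]
    simp only [div_eq_inv_mul]
  have hprob : IsProbabilityMeasure μ := hμt ▸ isProbabilityMeasure_tilted hexp
  have hintμ {f : E → ℝ} (hf : Continuous f) {K : ℝ} (hK : ∀ x, ‖f x‖ ≤ K * (1 + ‖x‖) ^ 2) :
      Integrable f μ := by
    rw [hμt, integrable_tilted_iff hexp]
    exact hint hf hK
  have hgradeq : (fun x => gradient V x) = G := gradient_eq hgrad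
  obtain ⟨A, hA0, hA⟩ : ∃ A : ℝ, 0 ≤ A ∧ ∀ x, ‖G x‖ ≤ A * (1 + ‖x‖) := by
    refine ⟨‖G 0‖ + 2 * C, by positivity, fun x => ?_⟩
    have h1 := hlip 0 x
    rw [sub_zero] at h1
    nlinarith [norm_le_norm_add_norm_sub (G 0) (G x), norm_sub_rev (G 0) (G x), norm_nonneg x,
      norm_nonneg (G 0), mul_nonneg (norm_nonneg (G 0)) (norm_nonneg x)]
  have hibp {h : E → ℝ} (hh : ContDiff ℝ 1 h) (v : E) {K L : ℝ}
      (hK : ∀ x, ‖h x‖ ≤ K * (1 + ‖x‖)) (hL : ∀ x, ‖fderiv ℝ h x v‖ ≤ L) :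
      Integrable (fun x => inner ℝ (G x) v * h x) μ ∧
        ∫ x, fderiv ℝ h x v ∂μ = ∫ x, inner ℝ (G x) v * h x ∂μ := by
    have hK0 : 0 ≤ K := by simpa using (norm_nonneg _).trans (hK 0)
    have hL0 : 0 ≤ L := (norm_nonneg _).trans (hL 0)
    have hdc : Continuous fun x => fderiv ℝ h x v :=
      (hh.continuous_fderiv one_ne_zero).clm_apply continuous_const
    have hhc : Continuous h := hh.continuous
    have b3 (x : E) : ‖inner ℝ (G x) v * h x‖ ≤ A * ‖v‖ * K * (1 + ‖x‖) ^ 2 := by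
      rw [norm_mul]
      calc _ ≤ (‖G x‖ * ‖v‖) * (K * (1 + ‖x‖)) := by
            gcongr
            exacts [norm_inner_le_norm _ _, hK x]
        _ ≤ (A * (1 + ‖x‖) * ‖v‖) * (K * (1 + ‖x‖)) := by gcongr; exact hA x
        _ = _ := by ring
    have c3 : Continuous fun x => inner ℝ (G x) v * h x := by fun_prop
    refine ⟨hintμ c3 b3, ?_⟩
    have key := integral_exp_neg_mul_fderiv hgrad (hh.differentiable one_ne_zero) v
      (hint (K := K) hhc fun x => (hK x).trans
        (by gcongr; nlinarith [norm_nonneg x]))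
      (hint (K := L) hdc fun x => (hL x).trans (le_mul_of_one_le_right hL0
        (by nlinarith [norm_nonneg x])))
      (hint c3 b3)
    rw [hμt, integral_tilted, integral_tilted]
    simp only [smul_eq_mul, div_mul_eq_mul_div] at key ⊢
    rw [integral_div, integral_div, key]
  have hGint : Integrable G μ := by
    refine (integrable_norm_iff hGcont.aestronglyMeasurable).1
      (hintμ (K := A) hGcont.norm fun x => ?_)
    rw [norm_norm]
    exact (hA x).trans (by gcongr; nlinarith [norm_nonneg x])
  have hidint : Integrable (fun x : E => x) μ := by
    refine (integrable_norm_iff continuous_id.aestronglyMeasurable).1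
      (hintμ (K := 1) continuous_norm fun x => ?_)
    rw [norm_norm, id]
    nlinarith [norm_nonneg x]
  rw [hgradeq]
  refine ⟨hGint, ?_, ?_⟩
  · refine ext_inner_right ℝ fun v => ?_
    have := (hibp (h := fun _ => 1) contDiff_const v (K := 1) (L := 0)
      (fun x => by simp) (fun x => by simp)).2
    rw [inner_zero_left, ← real_inner_comm, ← integral_inner hGint]
    simpa [real_inner_comm] using this.symm
  set a : E := ∫ y, y ∂μ with ha
  have hsub : Integrable (fun x => x - a) μ := hidint.sub (integrable_const a)
  have hsub0 : ∫ x, x - a ∂μ = 0 := by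
    rw [integral_sub hidint (integrable_const a), ← ha]
    simp
  let b := stdOrthonormalBasis ℝ E
  have hcoord (i) : Integrable (fun x => inner ℝ (G x) (b i) * inner ℝ (b i) (x - a)) μ ∧
      ∫ x, inner ℝ (G x) (b i) * inner ℝ (b i) (x - a) ∂μ = 1 := by
    have hd (x : E) : HasFDerivAt (fun x => inner ℝ (b i) (x - a)) (innerSL ℝ (b i)) x :=
      (innerSL ℝ (b i)).hasFDerivAt.comp x (hasFDerivAt_sub_const a)
    have hf (x : E) : fderiv ℝ (fun x => inner ℝ (b i) (x - a)) x (b i) = 1 := by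
      rw [(hd x).fderiv]
      simp
    obtain ⟨h1, h2⟩ := hibp (h := fun x => inner ℝ (b i) (x - a))
      (contDiff_const.inner ℝ (contDiff_id.sub contDiff_const)) (b i)
      (K := 1 + ‖a‖) (L := 1) (fun x => by
        refine (norm_inner_le_norm _ _).trans ?_
        rw [b.norm_eq_one, one_mul]
        nlinarith [norm_sub_le x a, norm_nonneg x, norm_nonneg a,
          mul_nonneg (norm_nonneg x) (norm_nonneg a)]) (fun x => by rw [hf, norm_one])
    refine ⟨h1, h2.symm.trans ?_⟩
    simp [hf]
  have hsum (x : E) : inner ℝ (G x) (x - a)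
      = ∑ i, inner ℝ (G x) (b i) * inner ℝ (b i) (x - a) :=
    (b.sum_inner_mul_inner _ _).symm
  have hi1 : Integrable (fun x => inner ℝ (G x) (x - a)) μ := by
    simp only [hsum]
    exact integrable_finsetSum _ fun i _ => (hcoord i).1
  have hI1 : ∫ x, inner ℝ (G x) (x - a) ∂μ = Module.finrank ℝ E := by
    simp only [hsum]
    rw [integral_finsetSum _ fun i _ => (hcoord i).1]
    simp [hcoord]
  have hi2 : Integrable (fun x => inner ℝ (G a) (x - a)) μ := hsub.const_inner (G a)
  have hi3 : Integrable (fun x => inner ℝ (G x - G a) (x - a)) μ := by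
    simp only [inner_sub_left]
    exact hi1.sub hi2
  have hI3 : ∫ x, inner ℝ (G x - G a) (x - a) ∂μ = Module.finrank ℝ E := by
    simp only [inner_sub_left]
    rw [integral_sub hi1 hi2, hI1, integral_inner hsub, hsub0, inner_zero_right, sub_zero]
  have hmono := inner_sub_bounds_of_quadratic_bounds hG a
  have hi4 : Integrable (fun x => ‖x - a‖ ^ 2) μ := by
    refine hintμ (K := (1 + ‖a‖) ^ 2) (by fun_prop) fun x => ?_
    rw [Real.norm_of_nonneg (by positivity), ← mul_pow]
    gcongr
    nlinarith [norm_sub_le x a, norm_nonneg x, norm_nonneg a,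
      mul_nonneg (norm_nonneg x) (norm_nonneg a)]
  constructor
  · rw [div_le_iff₀' hC, ← hI3, ← integral_const_mul]
    exact integral_mono hi3 (hi4.const_mul C) fun x => (hmono x).2
  · rw [le_div_iff₀' hc, ← hI3, ← integral_const_mul]
    exact integral_mono (hi4.const_mul c) hi3 fun x => (hmono x).1
end

section
/- Let E be a finite-dimensional real inner product space of dimension d, let 0 < c ≤ C, and let V : E → ℝ satisfy c ≤ HV ≤ C. Let μ = Z^{−1} e^{−V(x)} dx be the associated Gibbs measure and x̄ = ∫_E x dμ(x) its mean. Then for every x ∈ E, ‖∇V(x)‖ ≤ C (‖x − x̄‖ + (d/c)^{1/2}). -/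
open Set MeasureTheory

open Filter Topology

open scoped RealInnerProductSpace

section StrongConvexity

variable {E : Type*} [NormedAddCommGroup E] [InnerProductSpace ℝ E]

theorem StrongConvexOn.add_smul_le {f : E → ℝ} {m : ℝ} (hf : StrongConvexOn univ m f) (x h : E)
    {t : ℝ} (ht₀ : 0 ≤ t) (ht₁ : t ≤ 1) :
    f (x + t • h) ≤ (1 - t) * f x + t * f (x + h) - (1 - t) * t * (m / 2 * ‖h‖ ^ 2) := by
  have key := hf.2 (mem_univ x) (mem_univ (x + h)) (sub_nonneg.2 ht₁) ht₀ (by ring)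
  have e : (1 - t) • x + t • (x + h) = x + t • h := by module
  rw [e] at key
  simpa using key

theorem le_of_forall_add_mul_le {a b k : ℝ} (h : ∀ t : ℝ, 0 < t → t < 1 → a ≤ b + k * t) :
    a ≤ b := by
  have hlim : Tendsto (fun t : ℝ => b + k * t) (𝓝[>] 0) (𝓝 b) := by
    have : Continuous fun t : ℝ => b + k * t := by fun_prop
    simpa using (this.tendsto 0).mono_left nhdsWithin_le_nhds
  refine ge_of_tendsto hlim ?_
  filter_upwards [Ioo_mem_nhdsGT (zero_lt_one' ℝ)] with t ht using h t ht.1 ht.2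

/-- A strongly convex function grows quadratically away from its minimizer. -/
theorem StrongConvexOn.add_sq_le_of_forall_le {f : E → ℝ} {m : ℝ} (hf : StrongConvexOn univ m f)
    {p : E} (hp : ∀ y, f p ≤ f y) (h : E) : f p + m / 2 * ‖h‖ ^ 2 ≤ f (p + h) := by
  refine le_of_forall_add_mul_le (k := m / 2 * ‖h‖ ^ 2) fun t ht₀ ht₁ => ?_
  have h₁ := hf.add_smul_le p h ht₀.le ht₁.le
  have h₂ := hp (p + t • h)
  refine le_of_mul_le_mul_left ?_ ht₀
  linarith

/-- A semiconcave function grows at most quadratically away from its minimizer. -/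
theorem StrongConcaveOn.le_add_sq_of_forall_le {f : E → ℝ} {m : ℝ}
    (hf : StrongConcaveOn univ (-m) f) {p : E} (hp : ∀ y, f p ≤ f y) (h : E) :
    f (p + h) ≤ f p + m / 2 * ‖h‖ ^ 2 := by
  refine le_of_forall_add_mul_le (k := m / 2 * ‖h‖ ^ 2) fun s hs₀ _ => ?_
  have hs : (0 : ℝ) < 1 + s := by linarith
  have key := hf.2 (mem_univ (p + h)) (mem_univ (p - s • h)) (show 0 ≤ s / (1 + s) by positivity)
    (show 0 ≤ 1 / (1 + s) by positivity) (by field_simp; ring)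
  have e : (s / (1 + s)) • (p + h) + (1 / (1 + s)) • (p - s • h) = p := by
    match_scalars <;> field_simp <;> ring
  have e' : p + h - (p - s • h) = (1 + s) • h := by module
  rw [e, e', norm_smul, Real.norm_of_nonneg hs.le] at key
  simp only [smul_eq_mul] at key
  have h₂ := hp (p - s • h)
  have h₃ : 1 / (1 + s) * f p ≤ 1 / (1 + s) * f (p - s • h) := by gcongr
  have h₄ : s / (1 + s) * f (p + h) + 1 / (1 + s) * f p
      + s / (1 + s) * (1 / (1 + s)) * (-m / 2 * ((1 + s) * ‖h‖) ^ 2) ≤ f p := by linarith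
  have h₅ : s / (1 + s) * f (p + h) + 1 / (1 + s) * f p
      + s / (1 + s) * (1 / (1 + s)) * (-m / 2 * ((1 + s) * ‖h‖) ^ 2) =
      f p + s / (1 + s) * (f (p + h) - (f p + m / 2 * ‖h‖ ^ 2 + m / 2 * ‖h‖ ^ 2 * s)) := by
    field_simp
    ring
  rw [h₅] at h₄
  by_contra! hlt
  have : 0 < s / (1 + s) * (f (p + h) - (f p + m / 2 * ‖h‖ ^ 2 + m / 2 * ‖h‖ ^ 2 * s)) :=
    mul_pos (by positivity) (by linarith)
  linarith

/-- The first order condition for a strongly convex function. -/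
theorem StrongConvexOn.add_fderiv_add_sq_le {f : E → ℝ} {m : ℝ} (hf : StrongConvexOn univ m f)
    {x : E} {f' : E →L[ℝ] ℝ} (hx : HasFDerivAt f f' x) (h : E) :
    f x + f' h + m / 2 * ‖h‖ ^ 2 ≤ f (x + h) := by
  have hl : HasDerivAt (fun t : ℝ => f (x + t • h)) (f' h) 0 := by
    have h₁ : HasDerivAt (fun t : ℝ => x + t • h) h 0 := by
      simpa using ((hasDerivAt_id (0 : ℝ)).smul_const h).const_add x
    have h₂ : HasFDerivAt f f' (x + (0 : ℝ) • h) := by simpa using hx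
    exact h₂.comp_hasDerivAt 0 h₁
  have hs := hl.tendsto_slope_zero_right
  simp only [zero_add, zero_smul, add_zero, smul_eq_mul] at hs
  have hr : Tendsto (fun t : ℝ => f (x + h) - f x - (1 - t) * (m / 2 * ‖h‖ ^ 2)) (𝓝[>] 0)
      (𝓝 (f (x + h) - f x - m / 2 * ‖h‖ ^ 2)) := by
    have : Continuous fun t : ℝ => f (x + h) - f x - (1 - t) * (m / 2 * ‖h‖ ^ 2) := by fun_prop
    simpa using (this.tendsto 0).mono_left nhdsWithin_le_nhds
  have := le_of_tendsto_of_tendsto hs hr (by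
    filter_upwards [Ioo_mem_nhdsGT (zero_lt_one' ℝ)] with t ht
    rw [inv_mul_le_iff₀ ht.1]
    linarith [hf.add_smul_le x h ht.1.le ht.2.le])
  linarith

theorem StrongConcaveOn.le_add_fderiv_add_sq {f : E → ℝ} {m : ℝ}
    (hf : StrongConcaveOn univ (-m) f) {x : E} {f' : E →L[ℝ] ℝ} (hx : HasFDerivAt f f' x) (h : E) :
    f (x + h) ≤ f x + f' h + m / 2 * ‖h‖ ^ 2 := by
  have hn : StrongConvexOn univ (-m) (-f) := UniformConcaveOn.neg hf
  have := hn.add_fderiv_add_sq_le hx.neg h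
  simp only [Pi.neg_apply, neg_apply] at this
  linarith

/-- The gradient of a convex, `C`-semiconcave function at `x` is bounded by `C` times the distance
from `x` to a minimizer. -/
theorem norm_le_mul_norm_sub_of_forall_le [CompleteSpace E] {f : E → ℝ} {c C : ℝ} (hc : 0 ≤ c)
    (hC : 0 < C) (hf : StrongConvexOn univ c f) (hf' : StrongConcaveOn univ (-C) f) {p x g : E}
    (hp : ∀ y, f p ≤ f y) (hx : HasGradientAt f g x) : ‖g‖ ≤ C * ‖x - p‖ := by
  have hd : HasFDerivAt f (InnerProductSpace.toDual ℝ E g) x := hx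
  have h₁ := hf.add_fderiv_add_sq_le hd (p + C⁻¹ • g - x)
  have h₂ := hf'.le_add_sq_of_forall_le hp (C⁻¹ • g)
  have h₃ := hf'.le_add_fderiv_add_sq hd (-(C⁻¹ • g))
  have h₄ := hp (x + -(C⁻¹ • g))
  have h₅ : 0 ≤ c / 2 * ‖p + C⁻¹ • g - x‖ ^ 2 := by positivity
  have e : p + C⁻¹ • g - x = C⁻¹ • g - (x - p) := by abel
  have h₆ : ⟪g, x - p⟫ ≤ ‖g‖ * ‖x - p‖ := real_inner_le_norm _ _
  rw [add_sub_cancel] at h₁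
  rw [e] at h₁ h₅
  simp only [InnerProductSpace.toDual_apply_apply, inner_sub_right, inner_neg_right,
    inner_smul_right, real_inner_self_eq_norm_sq, norm_neg, norm_smul, norm_inv,
    Real.norm_of_nonneg hC.le] at h₁ h₂ h₃ h₆
  have e₁ : C / 2 * (C⁻¹ * ‖g‖) ^ 2 = C⁻¹ * ‖g‖ ^ 2 / 2 := by field_simp
  rw [e₁] at h₂ h₃
  have h₇ : C⁻¹ * ‖g‖ ^ 2 ≤ ‖g‖ * ‖x - p‖ := by linarith
  rw [inv_mul_le_iff₀ hC] at h₇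
  rcases (norm_nonneg g).eq_or_lt with h₀ | h₀
  · rw [← h₀]; positivity
  · refine le_of_mul_le_mul_left ?_ h₀
    linarith

theorem StrongConvexOn.exists_forall_le_of_hasFDerivAt [FiniteDimensional ℝ E] {f : E → ℝ} {c : ℝ}
    (hc : 0 < c) (hf : StrongConvexOn univ c f) (hcont : Continuous f) {x : E} {f' : E →L[ℝ] ℝ}
    (hx : HasFDerivAt f f' x) : ∃ p, ∀ y, f p ≤ f y := by
  refine hcont.exists_forall_le' x ?_
  have hev := (tendsto_dist_right_cocompact_atTop x).eventually_ge_atTop (2 / c * ‖f'‖)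
  filter_upwards [hev] with y hy
  rw [dist_eq_norm] at hy
  have h₁ := hf.add_fderiv_add_sq_le hx (y - x)
  rw [add_sub_cancel] at h₁
  have h₂ : -(‖f'‖ * ‖y - x‖) ≤ f' (y - x) := (abs_le.1 (f'.le_opNorm (y - x))).1
  have h₃ : ‖f'‖ * ‖y - x‖ ≤ c / 2 * ‖y - x‖ ^ 2 := by
    have : ‖f'‖ ≤ c / 2 * ‖y - x‖ := by
      calc ‖f'‖ = c / 2 * (2 / c * ‖f'‖) := by field_simp
        _ ≤ _ := by gcongr
    nlinarith [norm_nonneg (y - x)]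
  linarith

/-- Radial strong monotonicity of a strongly convex function around its minimizer. -/
theorem StrongConvexOn.add_smul_add_sq_le {f : E → ℝ} {m : ℝ} (hf : StrongConvexOn univ m f)
    {p : E} (hp : ∀ y, f p ≤ f y) (h : E) {t : ℝ} (ht₀ : 0 ≤ t) (ht₁ : t ≤ 1) :
    f (p + t • h) + m / 2 * (1 - t ^ 2) * ‖h‖ ^ 2 ≤ f (p + h) := by
  have h₁ := hf.add_smul_le p h ht₀ ht₁
  have h₂ := mul_le_mul_of_nonneg_left (hf.add_sq_le_of_forall_le hp h) (sub_nonneg.2 ht₁)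
  linarith

end StrongConvexity

section Moments

variable {E : Type*} [NormedAddCommGroup E] [InnerProductSpace ℝ E]

theorem exp_neg_mul_one_add_le_of_radial {W : E → ℝ} {c : ℝ}
    (h : ∀ y : E, ∀ t : ℝ, 0 ≤ t → t ≤ 1 → W (t • y) + c / 2 * (1 - t ^ 2) * ‖y‖ ^ 2 ≤ W y)
    (y : E) {t : ℝ} (ht₀ : 0 ≤ t) (ht₁ : t ≤ 1) :
    Real.exp (-W y) + c / 2 * (1 - t ^ 2) * (‖y‖ ^ 2 * Real.exp (-W y))
      ≤ Real.exp (-W (t • y)) := by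
  calc _ = Real.exp (-W y) * (c / 2 * (1 - t ^ 2) * ‖y‖ ^ 2 + 1) := by ring
    _ ≤ Real.exp (-W y) * Real.exp (c / 2 * (1 - t ^ 2) * ‖y‖ ^ 2) := by
        gcongr
        exact Real.add_one_le_exp _
    _ = Real.exp (-W y + c / 2 * (1 - t ^ 2) * ‖y‖ ^ 2) := (Real.exp_add _ _).symm
    _ ≤ _ := by
        gcongr
        linarith [h y t ht₀ ht₁]

variable [FiniteDimensional ℝ E] [MeasurableSpace E] [BorelSpace E]

theorem integrable_exp_neg_mul_sq_norm {b : ℝ} (hb : 0 < b) :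
    Integrable fun y : E => Real.exp (-(b * ‖y‖ ^ 2)) := by
  have := (GaussianFourier.integrable_cexp_neg_mul_sq_norm_add (V := E) (b := (b : ℂ))
    (by simpa using hb) 0 0).norm
  refine this.congr (Eventually.of_forall fun y => ?_)
  simp [Complex.norm_exp, ← Complex.ofReal_pow]

variable {W : E → ℝ} {c : ℝ}

theorem integrable_exp_neg_of_radial (hc : 0 < c) (hW : Continuous W)
    (h : ∀ y : E, ∀ t : ℝ, 0 ≤ t → t ≤ 1 → W (t • y) + c / 2 * (1 - t ^ 2) * ‖y‖ ^ 2 ≤ W y) :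
    Integrable fun y => Real.exp (-W y) := by
  refine ((integrable_exp_neg_mul_sq_norm (E := E) (half_pos hc)).const_mul
    (Real.exp (-W 0))).mono' (by fun_prop) (Eventually.of_forall fun y => ?_)
  rw [Real.norm_of_nonneg (Real.exp_pos _).le, ← Real.exp_add]
  have := h y 0 le_rfl zero_le_one
  simp only [zero_smul] at this
  gcongr
  linarith

theorem integrable_sq_norm_mul_exp_neg_of_radial (hc : 0 < c) (hW : Continuous W)
    (h : ∀ y : E, ∀ t : ℝ, 0 ≤ t → t ≤ 1 → W (t • y) + c / 2 * (1 - t ^ 2) * ‖y‖ ^ 2 ≤ W y) :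
    Integrable fun y => ‖y‖ ^ 2 * Real.exp (-W y) := by
  have hint := (integrable_exp_neg_of_radial hc hW h).comp_smul (R := (1 / 2 : ℝ)) (by norm_num)
  refine (hint.const_mul (8 / (3 * c))).mono' (by fun_prop) (Eventually.of_forall fun y => ?_)
  rw [Real.norm_of_nonneg (by positivity)]
  have h₁ := exp_neg_mul_one_add_le_of_radial h y (t := 1 / 2) (by norm_num) (by norm_num)
  have h₂ := Real.exp_pos (-W y)
  calc ‖y‖ ^ 2 * Real.exp (-W y)
      = 8 / (3 * c) * (c / 2 * (1 - (1 / 2) ^ 2) * (‖y‖ ^ 2 * Real.exp (-W y))) := by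
        field_simp; ring
    _ ≤ _ := by gcongr; linarith

/-- The second moment bound for a potential that is strongly convex along rays from the origin,
obtained by differentiating `t ↦ ∫ exp (-W (t • y))` at `t = 1`. -/
theorem mul_integral_sq_norm_mul_exp_neg_le (hc : 0 < c) (hW : Continuous W)
    (h : ∀ y : E, ∀ t : ℝ, 0 ≤ t → t ≤ 1 → W (t • y) + c / 2 * (1 - t ^ 2) * ‖y‖ ^ 2 ≤ W y) :
    c * ∫ y, ‖y‖ ^ 2 * Real.exp (-W y) ≤ Module.finrank ℝ E * ∫ y, Real.exp (-W y) := by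
  have hi₀ := integrable_exp_neg_of_radial hc hW h
  have hi₂ := integrable_sq_norm_mul_exp_neg_of_radial hc hW h
  set d := Module.finrank ℝ E
  set Z := ∫ y, Real.exp (-W y)
  set M := ∫ y, ‖y‖ ^ 2 * Real.exp (-W y)
  have hZ : 0 ≤ Z := integral_nonneg fun y => (Real.exp_pos _).le
  have hM : 0 ≤ M := integral_nonneg fun y => by positivity
  have key : ∀ t : ℝ, 0 < t → t ≤ 1 → t ^ d * (Z + c / 2 * (1 - t ^ 2) * M) ≤ Z := by
    intro t ht₀ ht₁
    have h₁ : Z + c / 2 * (1 - t ^ 2) * M ≤ ∫ y, Real.exp (-W (t • y)) := by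
      rw [← integral_const_mul, ← integral_add hi₀ (hi₂.const_mul _)]
      exact integral_mono (hi₀.add (hi₂.const_mul _)) (hi₀.comp_smul ht₀.ne')
        fun y => exp_neg_mul_one_add_le_of_radial h y ht₀.le ht₁
    rw [Measure.integral_comp_smul_of_nonneg volume (fun y => Real.exp (-W y)) t (hR := ht₀.le),
      smul_eq_mul] at h₁
    calc _ ≤ t ^ d * ((t ^ d)⁻¹ * Z) := by gcongr
      _ = Z := by rw [mul_inv_cancel_left₀ (by positivity)]
  refine le_of_forall_add_mul_le (k := c * M / 2 + d * c * M) fun u hu₀ hu₁ => ?_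
  have h₁ := key (1 - u) (by linarith) (by linarith)
  have h₂ : 1 + d * (-u) ≤ (1 + -u) ^ d := one_add_mul_le_pow (by linarith) d
  rw [← sub_eq_add_neg] at h₂
  have h₃ : 0 ≤ c / 2 * (1 - (1 - u) ^ 2) * M := by
    have : 0 ≤ 1 - (1 - u) ^ 2 := by nlinarith
    positivity
  have h₄ := (mul_le_mul_of_nonneg_right h₂ (add_nonneg hZ h₃)).trans h₁
  refine le_of_mul_le_mul_left ?_ hu₀
  have h₅ : 0 ≤ d * c * M * u ^ 3 := by positivity
  linarith

end Moments

section Mean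

variable {E : Type*} [NormedAddCommGroup E] [InnerProductSpace ℝ E] [CompleteSpace E]
  [MeasurableSpace E]

theorem sq_norm_integral_le_integral_sq_norm {μ : Measure E} [IsProbabilityMeasure μ] {f : E → E}
    (hf : Integrable f μ) (hf₂ : Integrable (fun y => ‖f y‖ ^ 2) μ) :
    ‖∫ y, f y ∂μ‖ ^ 2 ≤ ∫ y, ‖f y‖ ^ 2 ∂μ := by
  set m := ∫ y, f y ∂μ with hm
  have h₁ : ∫ y, (2 * ⟪m, f y⟫ - ‖m‖ ^ 2) ∂μ ≤ ∫ y, ‖f y‖ ^ 2 ∂μ := by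
    refine integral_mono (((hf.const_inner m).const_mul 2).sub (integrable_const _)) hf₂ fun y => ?_
    have := norm_sub_sq_real m (f y)
    have := sq_nonneg ‖m - f y‖
    simp only
    linarith
  rw [integral_sub ((hf.const_inner m).const_mul 2) (integrable_const _), integral_const_mul,
    integral_inner hf, ← hm, real_inner_self_eq_norm_sq] at h₁
  simp only [integral_const, probReal_univ, smul_eq_mul] at h₁
  linarith

end Mean

/-- The mean of the Gibbs measure of a `c`-strongly convex potential lies within `√(d/c)` of the
minimizer. -/
theorem norm_integral_sub_minimizer_le {E : Type*} [NormedAddCommGroup E] [InnerProductSpace ℝ E]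
    [FiniteDimensional ℝ E] [MeasurableSpace E] [BorelSpace E] {c : ℝ} (hc : 0 < c) {V : E → ℝ}
    (hV : Continuous V) (hconv : StrongConvexOn univ c V) {p : E} (hp : ∀ y, V p ≤ V y) :
    ‖(∫ y, y ∂((volume : Measure E).withDensity
      (fun x => ENNReal.ofReal ((∫ y, Real.exp (-V y))⁻¹ * Real.exp (-V x))))) - p‖ ≤
      Real.sqrt ((Module.finrank ℝ E : ℝ) / c) := by
  have hrad : ∀ y : E, ∀ t : ℝ, 0 ≤ t → t ≤ 1 →
      V (p + t • y) + c / 2 * (1 - t ^ 2) * ‖y‖ ^ 2 ≤ V (p + y) :=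
    fun y t h₀ h₁ => hconv.add_smul_add_sq_le hp y h₀ h₁
  have hW : Continuous fun y => V (p + y) := by fun_prop
  have hi₀ := integrable_exp_neg_of_radial hc hW hrad
  have hi₂ := integrable_sq_norm_mul_exp_neg_of_radial hc hW hrad
  have hmom := mul_integral_sq_norm_mul_exp_neg_le hc hW hrad
  rw [integral_add_left_eq_self (fun y => Real.exp (-V y)) p] at hmom
  have hj₀ : Integrable fun y => Real.exp (-V y) := by simpa using hi₀.comp_add_left (-p)
  have hj₂ : Integrable fun y => ‖y - p‖ ^ 2 * Real.exp (-V y) := by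
    simpa [neg_add_eq_sub] using hi₂.comp_add_left (-p)
  have hmom' : ∫ y, ‖y - p‖ ^ 2 * Real.exp (-V y) = ∫ y, ‖y‖ ^ 2 * Real.exp (-V (p + y)) := by
    rw [← integral_add_left_eq_self (fun y => ‖y - p‖ ^ 2 * Real.exp (-V y)) p]
    simp
  rw [← hmom'] at hmom
  have hZ : 0 < ∫ y, Real.exp (-V y) := integral_exp_pos hj₀
  set Z := ∫ y, Real.exp (-V y)
  set ρ : E → ENNReal := fun x => ENNReal.ofReal (Z⁻¹ * Real.exp (-V x)) with hρ
  have hρm : Measurable ρ := by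
    have : Continuous fun x => Z⁻¹ * Real.exp (-V x) := by fun_prop
    exact this.measurable.ennreal_ofReal
  have hρt : ∀ᵐ x, ρ x < ⊤ := Eventually.of_forall fun x => ENNReal.ofReal_lt_top
  have hρr : ∀ x, (ρ x).toReal = Z⁻¹ * Real.exp (-V x) := fun x =>
    ENNReal.toReal_ofReal (by positivity)
  set μ := (volume : Measure E).withDensity ρ
  have hprob : IsProbabilityMeasure μ := by
    constructor
    rw [withDensity_apply _ MeasurableSet.univ, Measure.restrict_univ,
      ← ofReal_integral_eq_lintegral_ofReal (hj₀.const_mul _)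
        (Eventually.of_forall fun x => by positivity),
      integral_const_mul, inv_mul_cancel₀ hZ.ne', ENNReal.ofReal_one]
  have hsq : Integrable (fun y => ‖y - p‖ ^ 2) μ := by
    rw [integrable_withDensity_iff_integrable_smul' hρm hρt]
    refine (hj₂.const_mul Z⁻¹).congr (Eventually.of_forall fun x => ?_)
    simp only [hρr, smul_eq_mul]
    ring
  have hlin : Integrable (fun y => y - p) μ := by
    refine (hsq.add (integrable_const 1)).mono' (by fun_prop) (Eventually.of_forall fun y => ?_)
    simp only [Pi.add_apply]
    nlinarith [sq_nonneg (‖y - p‖ - 1)]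
  have hid : Integrable (fun y : E => y) μ := by
    refine (hlin.add (integrable_const p)).congr (Eventually.of_forall fun y => ?_)
    simp
  have hval : ∫ y, ‖y - p‖ ^ 2 ∂μ = Z⁻¹ * ∫ y, ‖y - p‖ ^ 2 * Real.exp (-V y) := by
    rw [integral_withDensity_eq_integral_toReal_smul hρm hρt, ← integral_const_mul]
    refine integral_congr_ae (Eventually.of_forall fun x => ?_)
    simp only [hρr, smul_eq_mul]
    ring
  have hfin := sq_norm_integral_le_integral_sq_norm hlin hsq
  rw [integral_sub hid (integrable_const p), hval] at hfin
  simp only [integral_const, probReal_univ, one_smul] at hfin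
  refine Real.le_sqrt_of_sq_le (hfin.trans ?_)
  rw [inv_mul_le_iff₀ hZ, mul_div_assoc', le_div_iff₀ hc]
  linarith

/-- for a potential `V` with `c ≤ HV ≤ C` on a `d`-dimensional real inner
product space, with Gibbs measure `μ = Z⁻¹ e^{-V(x)} dx` and mean `x̄`, one has
`‖∇V(x)‖ ≤ C (‖x - x̄‖ + (d/c)^{1/2})` for every `x`. -/
theorem stmt4 {E : Type*} [NormedAddCommGroup E] [InnerProductSpace ℝ E]
    [FiniteDimensional ℝ E] [MeasurableSpace E] [BorelSpace E]
    (c C : ℝ) (hc : 0 < c) (hcC : c ≤ C) (V : E → ℝ)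
    (hconv : ConvexOn ℝ univ (fun x => V x - c / 2 * ‖x‖ ^ 2))
    (hconc : ConcaveOn ℝ univ (fun x => V x - C / 2 * ‖x‖ ^ 2)) :
    ∀ μ : Measure E,
      μ = (volume : Measure E).withDensity
          (fun x => ENNReal.ofReal ((∫ y, Real.exp (-V y))⁻¹ * Real.exp (-V x))) →
      ∀ x : E,
        ‖gradient V x‖ ≤
          C * (‖x - ∫ y, y ∂μ‖ + Real.sqrt ((Module.finrank ℝ E : ℝ) / c)) := by
  rintro μ rfl x
  have hC : 0 < C := hc.trans_le hcC
  by_cases hx : DifferentiableAt ℝ V x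
  swap
  · rw [gradient_eq_zero_of_not_differentiableAt hx, norm_zero]
    positivity
  have hf : StrongConvexOn univ c V := strongConvexOn_iff_convex.2 hconv
  have hf' : StrongConcaveOn univ (-C) V := by
    refine strongConcaveOn_iff_convex.2 (hconc.congr fun y _ => ?_)
    ring
  have hV : Continuous V := by
    have h := (hconv.continuousOn isOpen_univ).add
      (show ContinuousOn (fun x : E => c / 2 * ‖x‖ ^ 2) univ by fun_prop)
    rw [← continuousOn_univ]
    exact h.congr fun y _ => by simp
  obtain ⟨p, hp⟩ := hf.exists_forall_le_of_hasFDerivAt hc hV hx.hasFDerivAt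
  refine (norm_le_mul_norm_sub_of_forall_le hc.le hC hf hf' hp hx.hasGradientAt).trans ?_
  gcongr
  refine (norm_sub_le_norm_sub_add_norm_sub _ _ _).trans
    (add_le_add_right (norm_integral_sub_minimizer_le hc hV hf hp) _)
end

section
/- Let E be a finite-dimensional real inner product space, and let A, B : E → E be positive definite self-adjoint linear maps. For each k ∈ ℕ let V_k : E → ℝ satisfy HV_k ≥ A and HV_k ≤ B, and let μ_k = Z_k^{−1} e^{−V_k(x)} dx be the associated Gibbs probability measure. Suppose that μ_k converges weakly to a probability measure μ which has finite first moment, and that the means ∫_E x dμ_k(x) are bounded in norm as k → ∞. Then there exists V : E → ℝ with HV ≥ A and HV ≤ B such that μ = Z^{−1} e^{−V(x)} dx. -/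
open Set MeasureTheory Filter
open scoped RealInnerProductSpace

/-- A sequence of convex functions on a finite-dimensional space which is uniformly bounded on
bounded sets has a pointwise convergent subsequence. -/
theorem exists_subseq_tendsto_of_convexOn_of_locally_bounded {E : Type*} [NormedAddCommGroup E]
    [NormedSpace ℝ E] [FiniteDimensional ℝ E] (g : ℕ → E → ℝ)
    (hg : ∀ k, ConvexOn ℝ univ (g k))
    (hbdd : ∀ r : ℝ, ∃ M : ℝ, ∀ k, ∀ x, ‖x‖ ≤ r → |g k x| ≤ M) :
    ∃ (s : ℕ → ℕ) (G : E → ℝ), StrictMono s ∧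
      ∀ x, Tendsto (fun n => g (s n) x) atTop (nhds (G x)) := by
  let U : Ultrafilter ℕ := hyperfilter ℕ
  have hlim : ∀ x, ∃ y, Tendsto (fun k => g k x) U (nhds y) := by
    intro x
    obtain ⟨M, hM⟩ := hbdd ‖x‖
    obtain ⟨y, -, hy⟩ := (isCompact_Icc (a := -M) (b := M)).ultrafilter_le_nhds
      (U.map fun k => g k x)
      (tendsto_principal.2 (Eventually.of_forall fun k => abs_le.1 (hM k x le_rfl)))
    exact ⟨y, hy⟩
  choose G hG using hlim
  have hequi : ∀ r : ℝ, EquicontinuousOn g (Metric.closedBall 0 r) := by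
    intro r
    obtain ⟨M, hM⟩ := hbdd (r + 2)
    refine UniformEquicontinuousOn.equicontinuousOn
      (LipschitzOnWith.uniformEquicontinuousOn g (2 * M / 1).toNNReal fun k => ?_)
    refine LipschitzOnWith.mono (ConvexOn.lipschitzOnWith_of_abs_le (x₀ := 0) (r := r + 2)
      ((hg k).subset (subset_univ _) (convex_ball _ _)) one_pos fun a ha => ?_)
      (Metric.closedBall_subset_ball (by linarith))
    exact hM k a (by simpa using ha.le)
  have hunif : ∀ r : ℝ, TendstoUniformlyOn g G U (Metric.closedBall 0 r) := by
    intro r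
    have := (EquicontinuousOn.tendsto_uniformOnFun_iff_pi (F := g)
      (𝔖 := range fun r : ℝ => Metric.closedBall (0 : E) r)
      (by rintro _ ⟨r, rfl⟩; exact isCompact_closedBall _ _)
      (by
        refine eq_univ_of_forall fun x => ?_
        exact ⟨_, ⟨‖x‖, rfl⟩, by simp⟩)
      (by rintro _ ⟨r, rfl⟩; exact hequi r) U G).2 (tendsto_pi_nhds.2 hG)
    exact UniformOnFun.tendsto_iff_tendstoUniformlyOn.1 this _ ⟨r, rfl⟩
  have hfreq : ∀ n : ℕ, ∃ᶠ k in atTop, ∀ x ∈ Metric.closedBall (0 : E) n,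
      dist (G x) (g k x) < 1 / ((n : ℝ) + 1) := by
    intro n
    have := Metric.tendstoUniformlyOn_iff.1 (hunif n) (1 / ((n : ℝ) + 1)) Nat.one_div_pos_of_nat
    exact this.frequently.filter_mono Nat.hyperfilter_le_atTop
  obtain ⟨s, hs, hsG⟩ := extraction_forall_of_frequently hfreq
  refine ⟨s, G, hs, fun x => ?_⟩
  rw [tendsto_iff_dist_tendsto_zero]
  refine squeeze_zero' (Eventually.of_forall fun n => dist_nonneg) ?_
    tendsto_one_div_add_atTop_nhds_zero_nat
  obtain ⟨N, hN⟩ := exists_nat_ge ‖x‖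
  filter_upwards [eventually_ge_atTop N] with n hn
  rw [dist_comm]
  refine (hsG n x ?_).le
  have : (N : ℝ) ≤ n := by exact_mod_cast hn
  simpa using hN.trans this

theorem convexOn_univ_of_tendsto {E : Type*} [AddCommGroup E] [Module ℝ E] {g : ℕ → E → ℝ}
    {G : E → ℝ} (hg : ∀ k, ConvexOn ℝ univ (g k))
    (hG : ∀ x, Tendsto (fun k => g k x) atTop (nhds (G x))) : ConvexOn ℝ univ G := by
  refine ⟨convex_univ, fun x _ y _ a b ha hb hab => ?_⟩
  exact le_of_tendsto_of_tendsto' (hG _) (((hG x).const_smul a).add ((hG y).const_smul b))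
    fun k => (hg k).2 (mem_univ x) (mem_univ y) ha hb hab

theorem continuous_of_convexOn_sub_inner {E : Type*} [NormedAddCommGroup E]
    [InnerProductSpace ℝ E] [FiniteDimensional ℝ E] {A : E →L[ℝ] E} {u : E → ℝ}
    (hu : ConvexOn ℝ univ (fun x => u x - (1 / 2) * ⟪A x, x⟫)) : Continuous u := by
  have h : Continuous fun x => (u x - (1 / 2) * ⟪A x, x⟫) + (1 / 2) * ⟪A x, x⟫ :=
    (continuousOn_univ.1 (hu.continuousOn isOpen_univ)).add (by fun_prop)
  simpa only [sub_add_cancel] using h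

/-- If the Hessian of `w` is at most `B`, then `w` satisfies the corresponding midpoint
inequality. -/
theorem add_sub_inner_le_two_mul_of_concaveOn {E : Type*} [NormedAddCommGroup E]
    [InnerProductSpace ℝ E] {B : E →L[ℝ] E} {w : E → ℝ}
    (hw : ConcaveOn ℝ univ (fun x => w x - (1 / 2) * ⟪B x, x⟫)) (x y : E) :
    w (x + y) + w (x - y) ≤ 2 * w x + ‖B‖ * ‖y‖ ^ 2 := by
  have h := hw.2 (mem_univ (x + y)) (mem_univ (x - y)) (show (0 : ℝ) ≤ 1 / 2 by norm_num)
    (show (0 : ℝ) ≤ 1 / 2 by norm_num) (by norm_num)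
  have hx : (1 / 2 : ℝ) • (x + y) + (1 / 2 : ℝ) • (x - y) = x := by module
  simp only [hx, smul_eq_mul, map_add, map_sub, inner_add_left, inner_add_right,
    inner_sub_left, inner_sub_right] at h
  have hBy : ⟪B y, y⟫ ≤ ‖B‖ * ‖y‖ ^ 2 :=
    (real_inner_le_norm _ _).trans <| by
      rw [pow_two, ← mul_assoc]
      exact mul_le_mul_of_nonneg_right (B.le_opNorm y) (norm_nonneg y)
  linarith

/-- A probability density `exp (-w)` is bounded in terms of an upper bound `B` on the Hessian
of `w`. -/
theorem exp_neg_mul_volume_ball_le {E : Type*} [NormedAddCommGroup E] [InnerProductSpace ℝ E]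
    [FiniteDimensional ℝ E] [MeasurableSpace E] [BorelSpace E] {B : E →L[ℝ] E} {w : E → ℝ}
    (hw : ConcaveOn ℝ univ (fun x => w x - (1 / 2) * ⟪B x, x⟫))
    (hint : ∫ x, Real.exp (-(w x)) = 1) (x : E) :
    Real.exp (-(w x)) * volume.real (Metric.closedBall (0 : E) 1) ≤ Real.exp (‖B‖ / 2) := by
  have hi : Integrable (fun x => Real.exp (-(w x))) :=
    Integrable.of_integral_ne_zero (by simp [hint])
  have hi₁ : Integrable (fun y => Real.exp (-(w (x + y)))) := hi.comp_add_left x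
  have hi₂ : Integrable (fun y => Real.exp (-(w (x - y)))) := hi.comp_sub_left x
  have hi₃ : Integrable fun y => Real.exp (‖B‖ / 2) *
      ((Real.exp (-(w (x + y))) + Real.exp (-(w (x - y)))) / 2) :=
    ((hi₁.add hi₂).div_const 2).const_mul _
  have hpt : ∀ y ∈ Metric.closedBall (0 : E) 1, Real.exp (-(w x)) ≤
      Real.exp (‖B‖ / 2) * ((Real.exp (-(w (x + y))) + Real.exp (-(w (x - y)))) / 2) := by
    intro y hy
    have hy1 : ‖y‖ ≤ 1 := by simpa using hy
    have h := add_sub_inner_le_two_mul_of_concaveOn hw x y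
    have hB : ‖B‖ * ‖y‖ ^ 2 ≤ ‖B‖ :=
      mul_le_of_le_one_right (norm_nonneg _) (pow_le_one₀ (norm_nonneg _) hy1)
    have h1 : Real.exp (-(w x)) ≤ Real.exp (‖B‖ / 2) *
        (Real.exp (-(w (x + y)) / 2) * Real.exp (-(w (x - y)) / 2)) := by
      rw [← Real.exp_add, ← Real.exp_add]
      exact Real.exp_le_exp.2 (by linarith)
    refine h1.trans (mul_le_mul_of_nonneg_left ?_ (Real.exp_nonneg _))
    have e : ∀ t : ℝ, Real.exp t = Real.exp (t / 2) ^ 2 := fun t => by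
      rw [pow_two, ← Real.exp_add, add_halves]
    rw [e (-(w (x + y))), e (-(w (x - y)))]
    linarith [sq_nonneg (Real.exp (-(w (x + y)) / 2) - Real.exp (-(w (x - y)) / 2))]
  calc Real.exp (-(w x)) * volume.real (Metric.closedBall (0 : E) 1)
      = ∫ _ in Metric.closedBall (0 : E) 1, Real.exp (-(w x)) := by
        rw [setIntegral_const, smul_eq_mul, mul_comm]
    _ ≤ ∫ y in Metric.closedBall (0 : E) 1, Real.exp (‖B‖ / 2) *
          ((Real.exp (-(w (x + y))) + Real.exp (-(w (x - y)))) / 2) :=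
        setIntegral_mono_on
          (integrableOn_const (isCompact_closedBall _ _).measure_lt_top.ne)
          hi₃.integrableOn Metric.isClosed_closedBall.measurableSet hpt
    _ ≤ ∫ y, Real.exp (‖B‖ / 2) *
          ((Real.exp (-(w (x + y))) + Real.exp (-(w (x - y)))) / 2) :=
        setIntegral_le_integral hi₃ (Eventually.of_forall fun y => by positivity)
    _ = Real.exp (‖B‖ / 2) := by
        rw [integral_const_mul, integral_div, integral_add hi₁ hi₂,
          integral_add_left_eq_self (fun y => Real.exp (-(w y))) x,
          integral_sub_left_eq_self (fun y => Real.exp (-(w y))) volume x, hint]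
        norm_num

/-- A continuous cutoff function equal to `1` on the ball of radius `r` and vanishing outside
the ball of radius `r + 1`. -/
noncomputable def normCutoff (E : Type*) [NormedAddCommGroup E] (r : ℝ) :
    BoundedContinuousFunction E ℝ :=
  BoundedContinuousFunction.ofNormedAddCommGroup
    (fun x => max 0 (min 1 (r + 1 - ‖x‖))) (by fun_prop) 1
    (fun x => by
      rw [Real.norm_of_nonneg (le_max_left _ _)]
      exact max_le zero_le_one (min_le_left _ _))

theorem normCutoff_apply {E : Type*} [NormedAddCommGroup E] (r : ℝ) (x : E) :
    normCutoff E r x = max 0 (min 1 (r + 1 - ‖x‖)) := rfl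

theorem normCutoff_nonneg {E : Type*} [NormedAddCommGroup E] (r : ℝ) (x : E) :
    0 ≤ normCutoff E r x := le_max_left _ _

theorem normCutoff_le_one {E : Type*} [NormedAddCommGroup E] (r : ℝ) (x : E) :
    normCutoff E r x ≤ 1 := max_le zero_le_one (min_le_left _ _)

theorem exists_half_lt_integral_normCutoff {E : Type*} [NormedAddCommGroup E]
    [MeasurableSpace E] [BorelSpace E] (μ : Measure E) [IsProbabilityMeasure μ] :
    ∃ n : ℕ, 1 / 2 < ∫ x, normCutoff E n x ∂μ := by
  have h : Tendsto (fun n : ℕ => ∫ x, normCutoff E n x ∂μ) atTop (nhds (∫ _, (1 : ℝ) ∂μ)) := by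
    refine tendsto_integral_of_dominated_convergence (fun _ => 1)
      (fun n => (normCutoff E n).continuous.measurable.aestronglyMeasurable)
      (integrable_const _) (fun n => Eventually.of_forall fun x => ?_)
      (Eventually.of_forall fun x => ?_)
    · rw [Real.norm_of_nonneg (normCutoff_nonneg _ _)]
      exact normCutoff_le_one _ _
    · refine tendsto_const_nhds.congr' ?_
      obtain ⟨N, hN⟩ := exists_nat_ge ‖x‖
      filter_upwards [eventually_ge_atTop N] with n hn
      have : (N : ℝ) ≤ n := by exact_mod_cast hn
      rw [normCutoff_apply, min_eq_left (by linarith), max_eq_right zero_le_one]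
  have h1 : (1 / 2 : ℝ) < ∫ _, (1 : ℝ) ∂μ := by
    rw [integral_const, probReal_univ]; norm_num
  exact (h.eventually_const_lt h1).exists

theorem integral_withDensity_exp_neg {E : Type*} [MeasurableSpace E] (ν : Measure E)
    {w : E → ℝ} (hw : Measurable w) (φ : E → ℝ) :
    ∫ x, φ x ∂(ν.withDensity fun x => ENNReal.ofReal (Real.exp (-(w x))))
      = ∫ x, Real.exp (-(w x)) * φ x ∂ν := by
  rw [integral_withDensity_eq_integral_toReal_smul (by fun_prop)
    (Eventually.of_forall fun x => ENNReal.ofReal_lt_top)]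
  simp only [ENNReal.toReal_ofReal (Real.exp_nonneg _), smul_eq_mul]

/-- Weak limits of probability measures with densities `exp (-w k)`, with two-sided bounds on the
Hessians of the `w k`, all charging a fixed ball. -/
theorem exists_potential_of_tendsto {E : Type*} [NormedAddCommGroup E]
    [InnerProductSpace ℝ E] [FiniteDimensional ℝ E] [MeasurableSpace E] [BorelSpace E]
    (A B : E →L[ℝ] E) (w : ℕ → E → ℝ)
    (hconv : ∀ k, ConvexOn ℝ univ (fun x => w k x - (1 / 2) * ⟪A x, x⟫))
    (hconc : ∀ k, ConcaveOn ℝ univ (fun x => w k x - (1 / 2) * ⟪B x, x⟫))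
    (hint : ∀ k, ∫ x, Real.exp (-(w k x)) = 1)
    (r : ℝ) (hr : ∀ k, 1 / 2 < ∫ x, Real.exp (-(w k x)) * normCutoff E r x)
    (μ : Measure E) [IsProbabilityMeasure μ]
    (hweak : ∀ φ : BoundedContinuousFunction E ℝ,
      Tendsto (fun k => ∫ x, Real.exp (-(w k x)) * φ x) atTop (nhds (∫ x, φ x ∂μ))) :
    ∃ W : E → ℝ,
      ConvexOn ℝ univ (fun x => W x - (1 / 2) * ⟪A x, x⟫) ∧
      ConcaveOn ℝ univ (fun x => W x - (1 / 2) * ⟪B x, x⟫) ∧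
      Continuous W ∧
      μ = (volume : Measure E).withDensity (fun x => ENNReal.ofReal (Real.exp (-(W x)))) := by
  have hv : 0 < volume.real (Metric.closedBall (0 : E) 1) :=
    ENNReal.toReal_pos (Metric.measure_closedBall_pos _ _ one_pos).ne'
      (isCompact_closedBall _ _).measure_lt_top.ne
  obtain ⟨C, hC⟩ : ∃ C : ℝ, ∀ k x, -C ≤ w k x := by
    refine ⟨Real.log (Real.exp (‖B‖ / 2) / volume.real (Metric.closedBall (0 : E) 1)),
      fun k x => ?_⟩
    have h := exp_neg_mul_volume_ball_le (hconc k) (hint k) x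
    rw [← le_div_iff₀ hv] at h
    have := (Real.le_log_iff_exp_le (by positivity)).2 h
    linarith
  obtain ⟨D, hD⟩ : ∃ D : ℝ, ∀ k, ∃ z : E, ‖z‖ ≤ r + 1 ∧ w k z ≤ D := by
    set b := volume.real (Metric.closedBall (0 : E) (r + 1)) with hb
    have hb0 : 0 ≤ b := measureReal_nonneg
    refine ⟨Real.log (2 * (b + 1)), fun k => ?_⟩
    by_contra! hcon
    have hle : ∫ x, Real.exp (-(w k x)) * normCutoff E r x
        ≤ ∫ _ in Metric.closedBall (0 : E) (r + 1), (2 * (b + 1))⁻¹ := by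
      rw [← integral_indicator Metric.isClosed_closedBall.measurableSet]
      refine integral_mono_of_nonneg
        (Eventually.of_forall fun x => mul_nonneg (Real.exp_nonneg _) (normCutoff_nonneg _ _))
        ((integrable_indicator_iff Metric.isClosed_closedBall.measurableSet).2
          (integrableOn_const (isCompact_closedBall _ _).measure_lt_top.ne))
        (Eventually.of_forall fun x => ?_)
      by_cases hx : ‖x‖ ≤ r + 1
      · have hx' : x ∈ Metric.closedBall (0 : E) (r + 1) := by simpa using hx
        simp only [indicator_of_mem hx']
        refine (mul_le_of_le_one_right (Real.exp_nonneg _) (normCutoff_le_one _ _)).trans ?_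
        rw [← Real.exp_log (show 0 < 2 * (b + 1) by positivity), ← Real.exp_neg]
        exact Real.exp_le_exp.2 (neg_le_neg (hcon x hx).le)
      · have hx' : x ∉ Metric.closedBall (0 : E) (r + 1) := by simpa using hx
        have h0 : normCutoff E r x = 0 := by
          rw [normCutoff_apply]
          exact max_eq_left ((min_le_right _ _).trans (by linarith))
        simp only [indicator_of_notMem hx', h0, mul_zero, le_refl]
    rw [setIntegral_const, smul_eq_mul, ← hb, ← div_eq_mul_inv,
      le_div_iff₀ (by positivity)] at hle
    nlinarith [hr k]
  have hub : ∀ k x, w k x ≤ 2 * D + C + ‖B‖ * (‖x‖ + (r + 1)) ^ 2 := by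
    intro k x
    obtain ⟨z, hz, hzD⟩ := hD k
    have h := add_sub_inner_le_two_mul_of_concaveOn (hconc k) z (x - z)
    rw [add_sub_cancel] at h
    have h1 := hC k (z - (x - z))
    have h2 : ‖B‖ * ‖x - z‖ ^ 2 ≤ ‖B‖ * (‖x‖ + (r + 1)) ^ 2 := by
      gcongr
      exact (norm_sub_le x z).trans (by linarith)
    linarith
  have hr0 : 0 ≤ r + 1 := by
    obtain ⟨z, hz, -⟩ := hD 0
    exact (norm_nonneg z).trans hz
  have hbdd : ∀ ρ : ℝ, ∃ M : ℝ, ∀ k, ∀ x, ‖x‖ ≤ ρ →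
      |w k x - (1 / 2) * ⟪A x, x⟫| ≤ M := by
    intro ρ
    refine ⟨|C| + |2 * D + C| + ‖B‖ * (ρ + (r + 1)) ^ 2 + ‖A‖ * ρ ^ 2, fun k x hx => ?_⟩
    have h1 := hC k x
    have h2 := hub k x
    have h3 : ‖B‖ * (‖x‖ + (r + 1)) ^ 2 ≤ ‖B‖ * (ρ + (r + 1)) ^ 2 := by gcongr
    have h4 : |⟪A x, x⟫| ≤ ‖A‖ * ρ ^ 2 := by
      refine (abs_real_inner_le_norm _ _).trans ?_
      calc ‖A x‖ * ‖x‖ ≤ (‖A‖ * ‖x‖) * ‖x‖ := by gcongr; exact A.le_opNorm x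
        _ = ‖A‖ * ‖x‖ ^ 2 := by ring
        _ ≤ ‖A‖ * ρ ^ 2 := by gcongr
    have h5 := abs_le.1 h4
    have h6 : 0 ≤ ‖B‖ * (‖x‖ + (r + 1)) ^ 2 := by positivity
    have h7 := le_abs_self C
    have h8 := le_abs_self (2 * D + C)
    have h9 := abs_nonneg C
    have h10 := abs_nonneg (2 * D + C)
    rw [abs_le]
    constructor <;> linarith [h5.1, h5.2]
  obtain ⟨s, G, hs, hG⟩ := exists_subseq_tendsto_of_convexOn_of_locally_bounded _ hconv hbdd
  have hW : ∀ x, Tendsto (fun n => w (s n) x) atTop (nhds (G x + (1 / 2) * ⟪A x, x⟫)) := by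
    intro x
    simpa using (hG x).add_const ((1 / 2) * ⟪A x, x⟫)
  set W : E → ℝ := fun x => G x + (1 / 2) * ⟪A x, x⟫ with hWdef
  have hWA : ConvexOn ℝ univ (fun x => W x - (1 / 2) * ⟪A x, x⟫) :=
    convexOn_univ_of_tendsto (fun n => hconv (s n)) fun x => (hW x).sub_const _
  have hWB : ConcaveOn ℝ univ (fun x => W x - (1 / 2) * ⟪B x, x⟫) :=
    neg_convexOn_iff.1 <| convexOn_univ_of_tendsto (fun n => (hconc (s n)).neg)
      fun x => ((hW x).sub_const _).neg
  have hWc := continuous_of_convexOn_sub_inner hWA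
  refine ⟨W, hWA, hWB, hWc, ?_⟩
  have : IsLocallyFiniteMeasure ((volume : Measure E).withDensity
      (fun x => ENNReal.ofReal (Real.exp (-(W x))))) :=
    IsLocallyFiniteMeasure.withDensity_ofReal (by fun_prop)
  refine Measure.ext_of_integral_eq_on_compactlySupported fun φ => ?_
  rw [integral_withDensity_exp_neg _ hWc.measurable]
  obtain ⟨K, hK⟩ := φ.continuous.bounded_above_of_compact_support φ.hasCompactSupport
  have hφ := (hweak (BoundedContinuousFunction.ofNormedAddCommGroup φ φ.continuous K hK)).comp
    hs.tendsto_atTop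
  refine tendsto_nhds_unique hφ ?_
  have hφi : Integrable φ (volume : Measure E) :=
    φ.continuous.integrable_of_hasCompactSupport φ.hasCompactSupport
  refine tendsto_integral_of_dominated_convergence (fun x => Real.exp C * ‖φ x‖)
    (fun n => ?_) (hφi.norm.const_mul _)
    (fun n => Eventually.of_forall fun x => ?_) (Eventually.of_forall fun x => ?_)
  · have := continuous_of_convexOn_sub_inner (hconv (s n))
    exact Continuous.aestronglyMeasurable (by
      simp only [BoundedContinuousFunction.coe_ofNormedAddCommGroup]
      fun_prop)
  · rw [norm_mul, Real.norm_of_nonneg (Real.exp_nonneg _)]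
    exact mul_le_mul_of_nonneg_right (Real.exp_le_exp.2 (by linarith [hC (s n) x]))
      (norm_nonneg _)
  · exact ((hW x).neg.rexp).mul_const _

/-- a weak limit of Gibbs measures with uniform two-sided Hessian bounds
`A ≤ HV_k ≤ B` (with `A`, `B` positive definite self-adjoint) and bounded means is again a
Gibbs measure given by a potential satisfying the same Hessian bounds. -/
theorem stmt5 {E : Type*} [NormedAddCommGroup E] [InnerProductSpace ℝ E]
    [FiniteDimensional ℝ E] [MeasurableSpace E] [BorelSpace E]
    (A B : E →L[ℝ] E)
    (hA : ∀ x y : E, ⟪A x, y⟫ = ⟪x, A y⟫)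
    (hApos : ∀ x : E, x ≠ 0 → 0 < ⟪A x, x⟫)
    (hB : ∀ x y : E, ⟪B x, y⟫ = ⟪x, B y⟫)
    (hBpos : ∀ x : E, x ≠ 0 → 0 < ⟪B x, x⟫)
    (V : ℕ → E → ℝ)
    (hconv : ∀ k, ConvexOn ℝ univ (fun x => V k x - (1 / 2) * ⟪A x, x⟫))
    (hconc : ∀ k, ConcaveOn ℝ univ (fun x => V k x - (1 / 2) * ⟪B x, x⟫))
    (μseq : ℕ → Measure E)
    (hμseq : ∀ k, μseq k = (volume : Measure E).withDensity
      (fun x => ENNReal.ofReal ((∫ y, Real.exp (-(V k y)))⁻¹ * Real.exp (-(V k x)))))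
    (μ : Measure E) [IsProbabilityMeasure μ]
    (hmom : Integrable (fun x => ‖x‖) μ)
    (hweak : ∀ φ : BoundedContinuousFunction E ℝ,
      Tendsto (fun k => ∫ x, φ x ∂(μseq k)) atTop (nhds (∫ x, φ x ∂μ)))
    (hmean : ∃ M : ℝ, ∀ k, ‖∫ x, x ∂(μseq k)‖ ≤ M) :
    ∃ W : E → ℝ,
      ConvexOn ℝ univ (fun x => W x - (1 / 2) * ⟪A x, x⟫) ∧
      ConcaveOn ℝ univ (fun x => W x - (1 / 2) * ⟪B x, x⟫) ∧
      μ = (volume : Measure E).withDensity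
        (fun x => ENNReal.ofReal ((∫ y, Real.exp (-(W y)))⁻¹ * Real.exp (-(W x)))) := by
  obtain ⟨n, hn⟩ := exists_half_lt_integral_normCutoff μ
  obtain ⟨N, hN⟩ := eventually_atTop.1 ((hweak (normCutoff E n)).eventually_const_lt hn)
  have hZ : ∀ k, N ≤ k → 0 < ∫ y, Real.exp (-(V k y)) := by
    intro k hk
    refine lt_of_le_of_ne (integral_nonneg fun y => Real.exp_nonneg _) fun h0 => ?_
    have h := hN k hk
    rw [hμseq k, ← h0] at h
    norm_num at h
  let w : ℕ → E → ℝ := fun k x => V (k + N) x + Real.log (∫ y, Real.exp (-(V (k + N) y)))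
  have hwexp : ∀ k x, Real.exp (-(w k x)) =
      (∫ y, Real.exp (-(V (k + N) y)))⁻¹ * Real.exp (-(V (k + N) x)) := by
    intro k x
    rw [show -(w k x) = -Real.log (∫ y, Real.exp (-(V (k + N) y))) + -(V (k + N) x) by
      simp only [w]; ring, Real.exp_add, Real.exp_neg, Real.exp_log (hZ _ (Nat.le_add_left N k))]
  have hμw : ∀ k, μseq (k + N) = (volume : Measure E).withDensity
      fun x => ENNReal.ofReal (Real.exp (-(w k x))) := by
    intro k
    simp only [hμseq (k + N), hwexp]
  have hwc : ∀ k, Measurable (w k) := fun k => ((continuous_of_convexOn_sub_inner (hconv (k + N))).add_const _).measurable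
  obtain ⟨W, hWA, hWB, hWc, hWμ⟩ := exists_potential_of_tendsto A B w
    (fun k => by
      refine ((hconv (k + N)).add_const (Real.log (∫ y, Real.exp (-(V (k + N) y))))).congr ?_
      intro x _
      simp only [w, Pi.add_apply]
      ring)
    (fun k => by
      refine ((hconc (k + N)).add_const (Real.log (∫ y, Real.exp (-(V (k + N) y))))).congr ?_
      intro x _
      simp only [w, Pi.add_apply]
      ring)
    (fun k => by
      simp only [hwexp]
      rw [integral_const_mul, inv_mul_cancel₀ (hZ _ (Nat.le_add_left N k)).ne'])
    n
    (fun k => by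
      rw [← integral_withDensity_exp_neg _ (hwc k), ← hμw k]
      exact hN _ (Nat.le_add_left N k))
    μ
    (fun φ => by
      refine ((hweak φ).comp (tendsto_add_atTop_nat N)).congr fun k => ?_
      rw [← integral_withDensity_exp_neg _ (hwc k), ← hμw k, Function.comp_apply])
  refine ⟨W, hWA, hWB, ?_⟩
  have h1 : ∫ y, Real.exp (-(W y)) = 1 := by
    have h := integral_withDensity_exp_neg (volume : Measure E) hWc.measurable (fun _ => 1)
    rw [← hWμ] at h
    simpa using h.symm
  simpa [h1] using hWμ
end

section
/- There exists a universal constant Θ > 0 with the following property. Let N ≥ 1, m ≥ 1, c > 0, and let μ be a probability measure on (M_N(ℂ)_sa)^m satisfying the normalized Herbst concentration inequality with constant c: for every function φ : (M_N(ℂ)_sa)^m → ℝ that is Lipschitz with respect to ‖·‖₂ and every δ > 0, φ is μ-integrable and μ{x : φ(x) ≥ ∫φ dμ + δ} ≤ exp(−cN²δ²/(2‖φ‖_Lip²)). Then for every function f : (M_N(ℂ)_sa)^m → M_N(ℂ) that is Lipschitz with respect to ‖·‖₂ on source and target and every δ > 0, μ{x : ‖f(x) − ∫ f dμ‖_∞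 ≥ c^{−1/2} ‖f‖_Lip (Θ + δ)} ≤ exp(−Nδ²/2). -/
open MeasureTheory

noncomputable section

/-- Measurable space structure on complex matrices (entrywise). -/
instance matrixMeasurableSpace (N : ℕ) :
    MeasurableSpace (Matrix (Fin N) (Fin N) ℂ) :=
  inferInstanceAs (MeasurableSpace (Fin N → Fin N → ℂ))

/-- The normalized `L²` (trace) norm `‖a‖₂ = ((1/N) Tr(a* a))^{1/2}` on `N × N` complex
matrices. -/
def matNorm2 {N : ℕ} (a : Matrix (Fin N) (Fin N) ℂ) : ℝ :=
  Real.sqrt ((Matrix.trace (Matrix.conjTranspose a * a)).re / N)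

/-- The operator norm `‖a‖_∞` of an `N × N` complex matrix, acting on `ℓ²`. -/
def matNormInf {N : ℕ} (a : Matrix (Fin N) (Fin N) ℂ) : ℝ :=
  ‖Matrix.toEuclideanCLM (𝕜 := ℂ) a‖

/-- The space of `m`-tuples of `N × N` Hermitian (self-adjoint) complex matrices. -/
def HermTuple (N m : ℕ) : Type :=
  Fin m → { a : Matrix (Fin N) (Fin N) ℂ // a.IsHermitian }

instance (N m : ℕ) : MeasurableSpace (HermTuple N m) :=
  inferInstanceAs (MeasurableSpace
    (Fin m → { a : Matrix (Fin N) (Fin N) ℂ // a.IsHermitian }))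

/-- The normalized `L²` distance on tuples of Hermitian matrices:
`dist₂(x, y) = (Σ_j ‖x_j - y_j‖₂²)^{1/2}`. -/
def tupleDist2 {N m : ℕ} (x y : HermTuple N m) : ℝ :=
  Real.sqrt (∑ j, (matNorm2 ((x j : Matrix (Fin N) (Fin N) ℂ) - (y j : Matrix (Fin N) (Fin N) ℂ))) ^ 2)

theorem matNorm2_nonneg {N : ℕ} (a : Matrix (Fin N) (Fin N) ℂ) : 0 ≤ matNorm2 a :=
  Real.sqrt_nonneg _

theorem tupleDist2_nonneg {N m : ℕ} (x y : HermTuple N m) : 0 ≤ tupleDist2 x y :=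
  Real.sqrt_nonneg _

theorem card_mul_matNorm2_sq {N : ℕ} (hN : 1 ≤ N) (a : Matrix (Fin N) (Fin N) ℂ) :
    (N : ℝ) * matNorm2 a ^ 2 = ∑ i, ∑ j, ‖a i j‖ ^ 2 := by
  have htr : (Matrix.trace (Matrix.conjTranspose a * a)).re = ∑ i, ∑ j, ‖a i j‖ ^ 2 := by
    rw [Finset.sum_comm]
    simp only [Matrix.trace, Matrix.diag, Matrix.mul_apply, Matrix.conjTranspose_apply,
      Complex.re_sum]
    refine Finset.sum_congr rfl fun i _ => Finset.sum_congr rfl fun j _ => ?_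
    rw [← Complex.normSq_eq_norm_sq, Complex.normSq_apply]
    simp
  have hN' : (N : ℝ) ≠ 0 := by positivity
  rw [matNorm2, Real.sq_sqrt, htr, mul_div_cancel₀ _ hN']
  rw [htr]
  positivity

theorem matNormInf_le_sqrt_mul_matNorm2 {N : ℕ} (hN : 1 ≤ N) (a : Matrix (Fin N) (Fin N) ℂ) :
    matNormInf a ≤ Real.sqrt N * matNorm2 a := by
  have h0 : 0 ≤ Real.sqrt N * matNorm2 a := mul_nonneg (Real.sqrt_nonneg _) (matNorm2_nonneg a)
  refine ContinuousLinearMap.opNorm_le_bound _ h0 fun v => ?_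
  refine le_of_sq_le_sq ?_ (mul_nonneg h0 (norm_nonneg v))
  rw [mul_pow, mul_pow, Real.sq_sqrt (Nat.cast_nonneg N), card_mul_matNorm2_sq hN,
    EuclideanSpace.norm_sq_eq, EuclideanSpace.norm_sq_eq, Finset.sum_mul]
  refine Finset.sum_le_sum fun i _ => ?_
  rw [Matrix.ofLp_toEuclideanCLM]
  calc ‖Matrix.mulVec a v.ofLp i‖ ^ 2 ≤ (∑ j, ‖a i j‖ * ‖v j‖) ^ 2 := by
        gcongr
        refine (norm_sum_le Finset.univ fun j => a i j * v j).trans_eq ?_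
        simp
    _ ≤ _ := Finset.sum_mul_sq_le_sq_mul_sq _ _ _

theorem abs_matNormInf_sub_le {N : ℕ} (a b : Matrix (Fin N) (Fin N) ℂ) :
    |matNormInf a - matNormInf b| ≤ matNormInf (a - b) := by
  unfold matNormInf
  rw [map_sub]
  exact abs_norm_sub_norm_le _ _

theorem norm_entry_le {N : ℕ} (hN : 1 ≤ N) (a : Matrix (Fin N) (Fin N) ℂ) (i j : Fin N) :
    ‖a i j‖ ≤ Real.sqrt N * matNorm2 a := by
  refine le_of_sq_le_sq ?_ (mul_nonneg (Real.sqrt_nonneg _) (matNorm2_nonneg a))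
  rw [mul_pow, Real.sq_sqrt (Nat.cast_nonneg N), card_mul_matNorm2_sq hN]
  calc ‖a i j‖ ^ 2 ≤ ∑ j, ‖a i j‖ ^ 2 :=
        Finset.single_le_sum (f := fun j => ‖a i j‖ ^ 2) (fun _ _ => by positivity)
          (Finset.mem_univ j)
    _ ≤ _ := Finset.single_le_sum (f := fun i => ∑ j, ‖a i j‖ ^ 2) (fun _ _ => by positivity)
          (Finset.mem_univ i)

/-- The ball of radius `2` has a maximal `1`-separated subset; it is a `1`-net. -/
theorem exists_net (E : Type*) [NormedAddCommGroup E] [NormedSpace ℝ E] [FiniteDimensional ℝ E] :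
    ∃ S : Finset E, (∀ s ∈ S, ‖s‖ ≤ 2) ∧ S.card ≤ 5 ^ Module.finrank ℝ E ∧
      ∀ v : E, ‖v‖ ≤ 2 → ∃ s ∈ S, ‖v - s‖ ≤ 1 := by
  classical
  let P : ℕ → Prop := fun n => ∃ S : Finset E, S.card = n ∧ (∀ s ∈ S, ‖s‖ ≤ 2) ∧
    ∀ c ∈ S, ∀ d ∈ S, c ≠ d → 1 ≤ ‖c - d‖
  have hP0 : P 0 := ⟨∅, by simp⟩
  obtain ⟨S, hcard, hS, hsep⟩ : P (Nat.findGreatest P (5 ^ Module.finrank ℝ E)) :=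
    Nat.findGreatest_spec (Nat.zero_le _) hP0
  refine ⟨S, hS, Besicovitch.card_le_of_separated S hS hsep, fun v hv => ?_⟩
  by_contra! hfar
  have hvS : v ∉ S := fun h => by
    have := hfar v h
    simp at this
    linarith
  have hS' : ∀ s ∈ insert v S, ‖s‖ ≤ 2 := by
    simpa using ⟨hv, hS⟩
  have hsep' : ∀ c ∈ insert v S, ∀ d ∈ insert v S, c ≠ d → 1 ≤ ‖c - d‖ := by
    intro c hc d hd hcd
    rcases Finset.mem_insert.1 hc with rfl | hcS <;> rcases Finset.mem_insert.1 hd with rfl | hdS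
    · exact absurd rfl hcd
    · exact (hfar d hdS).le
    · rw [norm_sub_rev]
      exact (hfar c hcS).le
    · exact hsep c hcS d hdS hcd
  have hle := Nat.le_findGreatest (P := P)
    (Besicovitch.card_le_of_separated (insert v S) hS' hsep') ⟨insert v S, rfl, hS', hsep'⟩
  rw [Finset.card_insert_of_notMem hvS] at hle
  omega

section Net

variable {E : Type*} [NormedAddCommGroup E] [InnerProductSpace ℂ E]

theorem norm_le_of_re_inner_le {S : Set E} (hS : ∀ v : E, ‖v‖ ≤ 2 → ∃ s ∈ S, ‖v - s‖ ≤ 1)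
    {t : ℝ} (w : E) (h : ∀ s ∈ S, (inner ℂ s w).re ≤ t) : ‖w‖ ≤ t := by
  rcases eq_or_ne w 0 with rfl | hw
  · obtain ⟨s, hs, -⟩ := hS 0 (by simp)
    simpa using h s hs
  have hw' : 0 < ‖w‖ := norm_pos_iff.2 hw
  set u : E := ((2 / ‖w‖ : ℝ) : ℂ) • w with hu
  have hu2 : ‖u‖ ≤ 2 := by
    rw [hu, norm_smul, Complex.norm_real, Real.norm_of_nonneg (by positivity),
      div_mul_cancel₀ _ hw'.ne']
  have huw : (inner ℂ u w).re = 2 * ‖w‖ := by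
    rw [hu, inner_smul_left, inner_self_eq_norm_sq_to_K]
    simp only [Complex.conj_ofReal, Complex.coe_algebraMap, ← Complex.ofReal_pow,
      ← Complex.ofReal_mul, Complex.ofReal_re]
    field_simp
  obtain ⟨s, hs, hus⟩ := hS u hu2
  have h1 : (inner ℂ (u - s) w).re ≤ ‖w‖ :=
    calc (inner ℂ (u - s) w).re ≤ ‖u - s‖ * ‖w‖ := re_inner_le_norm (𝕜 := ℂ) _ _
      _ ≤ 1 * ‖w‖ := by gcongr
      _ = ‖w‖ := one_mul _
  rw [inner_sub_left, Complex.sub_re, huw] at h1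
  linarith [h s hs]

theorem opNorm_le_of_norm_apply_le {S : Set E} (hS : ∀ v : E, ‖v‖ ≤ 2 → ∃ s ∈ S, ‖v - s‖ ≤ 1)
    {t : ℝ} (T : E →L[ℂ] E) (h : ∀ s ∈ S, ‖T s‖ ≤ t) : ‖T‖ ≤ t := by
  obtain ⟨s₀, hs₀, -⟩ := hS 0 (by simp)
  have ht : 0 ≤ t := (norm_nonneg _).trans (h s₀ hs₀)
  have key : ‖T‖ ≤ (t + ‖T‖) / 2 := by
    refine ContinuousLinearMap.opNorm_le_of_unit_norm (𝕜 := ℂ) (by positivity) fun v hv => ?_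
    have h2 : ‖(2 : ℂ) • v‖ = 2 := by rw [norm_smul, hv]; simp
    obtain ⟨s, hs, hvs⟩ := hS ((2 : ℂ) • v) h2.le
    have h3 : ‖T ((2 : ℂ) • v)‖ = 2 * ‖T v‖ := by rw [map_smul, norm_smul]; simp
    have h4 : ‖T ((2 : ℂ) • v)‖ ≤ ‖T s‖ + ‖T ((2 : ℂ) • v - s)‖ := by
      rw [map_sub]
      exact norm_le_insert' _ _
    have h5 : ‖T ((2 : ℂ) • v - s)‖ ≤ ‖T‖ * 1 := T.le_opNorm_of_le hvs
    linarith [h s hs]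
  linarith

end Net

theorem inner_toEuclideanCLM_eq_sum {N : ℕ} (a : Matrix (Fin N) (Fin N) ℂ)
    (u v : EuclideanSpace ℂ (Fin N)) :
    inner ℂ u (Matrix.toEuclideanCLM (𝕜 := ℂ) a v) =
      ∑ i, ∑ j, a i j * (v j * star (u i)) := by
  rw [PiLp.inner_apply]
  refine Finset.sum_congr rfl fun i _ => ?_
  rw [Matrix.ofLp_toEuclideanCLM, Matrix.mulVec, dotProduct, RCLike.inner_apply, Finset.sum_mul]
  refine Finset.sum_congr rfl fun j _ => ?_
  rw [mul_assoc]
  rfl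

theorem abs_re_inner_toEuclideanCLM_le {N : ℕ} (a : Matrix (Fin N) (Fin N) ℂ)
    {u v : EuclideanSpace ℂ (Fin N)} (hu : ‖u‖ ≤ 2) (hv : ‖v‖ ≤ 2) :
    |(inner ℂ u (Matrix.toEuclideanCLM (𝕜 := ℂ) a v)).re| ≤ 4 * matNormInf a := by
  have h0 : 0 ≤ matNormInf a := norm_nonneg _
  calc |(inner ℂ u (Matrix.toEuclideanCLM (𝕜 := ℂ) a v)).re|
      ≤ ‖inner ℂ u (Matrix.toEuclideanCLM (𝕜 := ℂ) a v)‖ := Complex.abs_re_le_norm _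
    _ ≤ ‖u‖ * ‖Matrix.toEuclideanCLM (𝕜 := ℂ) a v‖ := norm_inner_le_norm _ _
    _ ≤ 2 * (matNormInf a * 2) := by
        gcongr
        exact ContinuousLinearMap.le_opNorm_of_le _ hv
    _ = 4 * matNormInf a := by ring

theorem re_inner_integral {Ω : Type*} [MeasurableSpace Ω] {μ : Measure Ω} {N : ℕ}
    {f : Ω → Matrix (Fin N) (Fin N) ℂ} (hf : ∀ i j, Integrable (fun z => f z i j) μ)
    (u v : EuclideanSpace ℂ (Fin N)) :
    ∫ z, (inner ℂ u (Matrix.toEuclideanCLM (𝕜 := ℂ) (f z) v)).re ∂μ =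
      (inner ℂ u (Matrix.toEuclideanCLM (𝕜 := ℂ)
        (Matrix.of fun i j => ∫ z, f z i j ∂μ) v)).re := by
  simp only [inner_toEuclideanCLM_eq_sum, Matrix.of_apply]
  have hterm : ∀ i j, Integrable (fun z => f z i j * (v j * star (u i))) μ :=
    fun i j => (hf i j).mul_const _
  have hrow : ∀ i, Integrable (fun z => ∑ j, f z i j * (v j * star (u i))) μ :=
    fun i => integrable_finsetSum _ fun j _ => hterm i j
  have hre := integral_re (𝕜 := ℂ) (integrable_finsetSum Finset.univ fun i _ => hrow i)
  simp only [RCLike.re_to_complex] at hre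
  rw [hre, integral_finsetSum _ fun i _ => hrow i]
  congr 1
  refine Finset.sum_congr rfl fun i _ => ?_
  rw [integral_finsetSum _ fun j _ => hterm i j]
  exact Finset.sum_congr rfl fun j _ => integral_mul_const _ _

theorem exp_union_bound {N K : ℕ} (hN : 1 ≤ N) (hK : K ≤ 5 ^ (4 * N)) :
    (K : ℝ) * Real.exp (-(8 * N)) + Real.exp (-(2 * N)) < 1 := by
  have he : (2.7 : ℝ) < Real.exp 1 := lt_trans (by norm_num) Real.exp_one_gt_d9
  have hsmall : ∀ k : ℕ, Real.exp (-(k : ℝ)) ≤ ((2.7 : ℝ) ^ k)⁻¹ := fun k => by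
    rw [Real.exp_neg, ← Real.exp_one_pow]
    gcongr
  have h8 : Real.exp (-(8 * N)) ≤ ((1 : ℝ) / 2500) ^ N := by
    have h := hsmall 8
    calc Real.exp (-(8 * N)) = Real.exp (-((8 : ℕ) : ℝ)) ^ N := by
          rw [← Real.exp_nat_mul]; congr 1; push_cast; ring
      _ ≤ _ := by
          gcongr
          exact h.trans (by norm_num)
  have h2 : Real.exp (-(2 * N)) ≤ (1 : ℝ) / 4 := by
    have hN' : (1 : ℝ) ≤ N := by exact_mod_cast hN
    calc Real.exp (-(2 * N)) ≤ Real.exp (-((2 : ℕ) : ℝ)) := by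
          gcongr; push_cast; linarith
      _ ≤ _ := (hsmall 2).trans (by norm_num)
  have hK' : (K : ℝ) ≤ 625 ^ N := by
    have : (K : ℝ) ≤ 5 ^ (4 * N) := by exact_mod_cast hK
    rw [pow_mul] at this
    norm_num at this
    exact this
  have h1 : (K : ℝ) * Real.exp (-(8 * N)) ≤ 1 / 4 :=
    calc (K : ℝ) * Real.exp (-(8 * N)) ≤ 625 ^ N * (1 / 2500) ^ N := by gcongr
      _ = (1 / 4) ^ N := by rw [← mul_pow]; norm_num
      _ ≤ (1 / 4) ^ 1 := pow_le_pow_of_le_one (by norm_num) (by norm_num) hN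
      _ = 1 / 4 := pow_one _
  linarith

/-- The normalized Herbst concentration inequality with constant `c`. -/
def HerbstConcentration {N m : ℕ} (c : ℝ) (μ : Measure (HermTuple N m)) : Prop :=
  ∀ (φ : HermTuple N m → ℝ) (L : ℝ), 0 < L →
    (∀ x y, |φ x - φ y| ≤ L * tupleDist2 x y) →
    Integrable φ μ ∧
      ∀ δ : ℝ, 0 < δ →
        μ {x | (∫ z, φ z ∂μ) + δ ≤ φ x} ≤
          ENNReal.ofReal (Real.exp (-(c * (N : ℝ) ^ 2 * δ ^ 2) / (2 * L ^ 2)))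

namespace HerbstConcentration

variable {N m : ℕ} {c : ℝ} {μ : Measure (HermTuple N m)}

/-- Deviations of a function that is Lipschitz with the constant `r √N L`, at the scale
`L / √c`. -/
theorem measure_le (hμ : HerbstConcentration c μ) (hN : 1 ≤ N) (hc : 0 < c) {r L t : ℝ}
    (hr : 0 < r) (hL : 0 < L) (ht : 0 < t) {φ : HermTuple N m → ℝ}
    (hφ : ∀ x y, |φ x - φ y| ≤ r * (Real.sqrt N * L) * tupleDist2 x y) :
    μ {x | (∫ z, φ z ∂μ) + (Real.sqrt c)⁻¹ * L * t ≤ φ x} ≤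
      ENNReal.ofReal (Real.exp (-(N * t ^ 2 / (2 * r ^ 2)))) := by
  have hN' : (0 : ℝ) < N := by exact_mod_cast hN
  have hsc : 0 < Real.sqrt c := Real.sqrt_pos.2 hc
  refine ((hμ φ (r * (Real.sqrt N * L)) (by positivity) hφ).2 _ (by positivity)).trans_eq ?_
  congr 2
  rw [mul_pow, mul_pow, mul_pow, mul_pow, inv_pow, Real.sq_sqrt hc.le, Real.sq_sqrt hN'.le]
  field_simp

theorem integrable_entry (hμ : HerbstConcentration c μ) (hN : 1 ≤ N) {L : ℝ} (hL : 0 < L)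
    {f : HermTuple N m → Matrix (Fin N) (Fin N) ℂ}
    (hf : ∀ x y, matNorm2 (f x - f y) ≤ L * tupleDist2 x y) (i j : Fin N) :
    Integrable (fun z => f z i j) μ := by
  have hN' : (0 : ℝ) < N := by exact_mod_cast hN
  have hb : ∀ x y, ‖f x i j - f y i j‖ ≤ Real.sqrt N * L * tupleDist2 x y := fun x y => by
    refine (norm_entry_le hN (f x - f y) i j).trans ?_
    rw [mul_assoc]
    gcongr
    exact hf x y
  have hre := (hμ (fun z => (f z i j).re) (Real.sqrt N * L) (by positivity) fun x y =>
    (Complex.abs_re_le_norm (f x i j - f y i j)).trans (hb x y)).1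
  have him := (hμ (fun z => (f z i j).im) (Real.sqrt N * L) (by positivity) fun x y =>
    (Complex.abs_im_le_norm (f x i j - f y i j)).trans (hb x y)).1
  exact (Integrable.re_im_iff (𝕜 := ℂ)).1 ⟨hre, him⟩

theorem integral_matNormInf_le [IsProbabilityMeasure μ] (hμ : HerbstConcentration c μ)
    (hN : 1 ≤ N) (hc : 0 < c) {L : ℝ} (hL : 0 < L)
    {f : HermTuple N m → Matrix (Fin N) (Fin N) ℂ}
    (hf : ∀ x y, matNormInf (f x - f y) ≤ Real.sqrt N * L * tupleDist2 x y)
    (hint : ∀ i j, Integrable (fun z => f z i j) μ)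
    (hLip : ∀ M : Matrix (Fin N) (Fin N) ℂ, ∀ x y,
      |matNormInf (f x - M) - matNormInf (f y - M)| ≤ 1 * (Real.sqrt N * L) * tupleDist2 x y) :
    ∫ x, matNormInf (f x - Matrix.of fun i j => ∫ z, f z i j ∂μ) ∂μ ≤
      (Real.sqrt c)⁻¹ * L * 18 := by
  set M : Matrix (Fin N) (Fin N) ℂ := Matrix.of fun i j => ∫ z, f z i j ∂μ with hM
  obtain ⟨S, hS2, hcard, hnet⟩ := exists_net (EuclideanSpace ℂ (Fin N))
  have hdim : Module.finrank ℝ (EuclideanSpace ℂ (Fin N)) = 2 * N := by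
    rw [finrank_real_of_complex, finrank_euclideanSpace_fin]
  rw [hdim] at hcard
  let φ : EuclideanSpace ℂ (Fin N) × EuclideanSpace ℂ (Fin N) → HermTuple N m → ℝ :=
    fun p x => (inner ℂ p.1 (Matrix.toEuclideanCLM (𝕜 := ℂ) (f x) p.2)).re
  let A := fun p => {x | (∫ z, φ p z ∂μ) + (Real.sqrt c)⁻¹ * L * 16 ≤ φ p x}
  have hA : ∀ p ∈ S ×ˢ S, μ (A p) ≤ ENNReal.ofReal (Real.exp (-(8 * N))) := fun p hp => by
    obtain ⟨hp1, hp2⟩ := Finset.mem_product.1 hp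
    refine (hμ.measure_le hN hc (r := 4) (by norm_num) hL (by norm_num)
      fun x y => ?_).trans_eq ?_
    · have h := abs_re_inner_toEuclideanCLM_le (f x - f y) (hS2 _ hp1) (hS2 _ hp2)
      rw [map_sub, sub_apply, inner_sub_right, Complex.sub_re] at h
      refine h.trans ?_
      rw [mul_assoc 4]
      gcongr
      exact hf x y
    · congr 2
      ring
  let ψ : HermTuple N m → ℝ := fun x => -matNormInf (f x - M)
  let B := {x | (∫ z, ψ z ∂μ) + (Real.sqrt c)⁻¹ * L * 2 ≤ ψ x}
  have hB : μ B ≤ ENNReal.ofReal (Real.exp (-(2 * N))) := by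
    refine (hμ.measure_le hN hc (r := 1) (by norm_num) hL (by norm_num)
      fun x y => ?_).trans_eq ?_
    · rw [neg_sub_neg, abs_sub_comm]
      exact hLip M x y
    · congr 2
      ring
  have hlt : μ ((⋃ p ∈ S ×ˢ S, A p) ∪ B) < 1 := by
    calc μ ((⋃ p ∈ S ×ˢ S, A p) ∪ B) ≤ μ (⋃ p ∈ S ×ˢ S, A p) + μ B := measure_union_le _ _
      _ ≤ (∑ p ∈ S ×ˢ S, μ (A p)) + μ B := by
          gcongr
          exact measure_biUnion_finset_le _ _
      _ ≤ (∑ p ∈ S ×ˢ S, ENNReal.ofReal (Real.exp (-(8 * N)))) +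
            ENNReal.ofReal (Real.exp (-(2 * N))) := add_le_add (Finset.sum_le_sum hA) hB
      _ = ENNReal.ofReal (((S ×ˢ S).card : ℝ) * Real.exp (-(8 * N)) +
            Real.exp (-(2 * N))) := by
          rw [ENNReal.ofReal_add (by positivity) (by positivity),
            ENNReal.ofReal_mul (by positivity), ENNReal.ofReal_natCast, Finset.sum_const,
            nsmul_eq_mul]
      _ < 1 := by
          rw [← ENNReal.ofReal_one, ENNReal.ofReal_lt_ofReal_iff one_pos]
          refine exp_union_bound hN ?_
          rw [Finset.card_product]
          calc S.card * S.card ≤ 5 ^ (2 * N) * 5 ^ (2 * N) := Nat.mul_le_mul hcard hcard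
            _ = 5 ^ (4 * N) := by rw [← pow_add]; congr 1; ring
  obtain ⟨x, hx⟩ : ∃ x, x ∉ (⋃ p ∈ S ×ˢ S, A p) ∪ B := by
    by_contra! h
    rw [Set.eq_univ_of_forall h, measure_univ] at hlt
    exact lt_irrefl _ hlt
  rw [Set.mem_union, not_or] at hx
  obtain ⟨hxA, hxB⟩ := hx
  have hnorm : matNormInf (f x - M) ≤ (Real.sqrt c)⁻¹ * L * 16 := by
    refine opNorm_le_of_norm_apply_le (S := (S : Set _)) hnet _ fun v hv =>
      norm_le_of_re_inner_le (S := (S : Set _)) hnet _ fun u hu => ?_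
    have hxp : x ∉ A (u, v) := fun h =>
      hxA (Set.mem_biUnion (Finset.mk_mem_product hu hv) h)
    have hxp' : φ (u, v) x < (∫ z, φ (u, v) z ∂μ) + (Real.sqrt c)⁻¹ * L * 16 := not_le.1 hxp
    rw [re_inner_integral hint u v, ← hM] at hxp'
    rw [map_sub, sub_apply, inner_sub_right, Complex.sub_re]
    linarith
  have hxB' : ψ x < (∫ z, ψ z ∂μ) + (Real.sqrt c)⁻¹ * L * 2 := not_le.1 hxB
  rw [integral_neg] at hxB'
  change -matNormInf (f x - M) < _ at hxB'
  linarith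

end HerbstConcentration

/-- there is a universal constant `Θ > 0` such that any probability measure on
tuples of Hermitian matrices satisfying the normalized Herbst concentration inequality with
constant `c` satisfies operator-norm concentration for matrix-valued Lipschitz functions. -/
theorem stmt6 :
    ∃ Θ : ℝ, 0 < Θ ∧
      ∀ (N m : ℕ), 1 ≤ N → 1 ≤ m → ∀ (c : ℝ), 0 < c →
        ∀ μ : Measure (HermTuple N m), IsProbabilityMeasure μ →
        (∀ (φ : HermTuple N m → ℝ) (L : ℝ), 0 < L →
          (∀ x y, |φ x - φ y| ≤ L * tupleDist2 x y) →
          Integrable φ μ ∧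
            ∀ δ : ℝ, 0 < δ →
              μ {x | (∫ z, φ z ∂μ) + δ ≤ φ x} ≤
                ENNReal.ofReal (Real.exp (-(c * (N : ℝ) ^ 2 * δ ^ 2) / (2 * L ^ 2)))) →
        ∀ (f : HermTuple N m → Matrix (Fin N) (Fin N) ℂ) (L : ℝ), 0 < L →
          (∀ x y, matNorm2 (f x - f y) ≤ L * tupleDist2 x y) →
          ∀ δ : ℝ, 0 < δ →
            μ {x | (Real.sqrt c)⁻¹ * L * (Θ + δ) ≤
                matNormInf (f x - Matrix.of fun i j => ∫ z, f z i j ∂μ)} ≤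
              ENNReal.ofReal (Real.exp (-(N : ℝ) * δ ^ 2 / 2)) := by
  refine ⟨18, by norm_num, fun N m hN _ c hc μ _ hμ f L hL hf δ hδ => ?_⟩
  replace hμ : HerbstConcentration c μ := hμ
  have hf' : ∀ x y, matNormInf (f x - f y) ≤ Real.sqrt N * L * tupleDist2 x y := fun x y => by
    refine (matNormInf_le_sqrt_mul_matNorm2 hN _).trans ?_
    rw [mul_assoc]
    gcongr
    exact hf x y
  have hLip : ∀ M : Matrix (Fin N) (Fin N) ℂ, ∀ x y,
      |matNormInf (f x - M) - matNormInf (f y - M)| ≤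
        1 * (Real.sqrt N * L) * tupleDist2 x y := fun M x y => by
    rw [one_mul]
    refine (abs_matNormInf_sub_le _ _).trans ?_
    rw [sub_sub_sub_cancel_right]
    exact hf' x y
  have hmean := hμ.integral_matNormInf_le hN hc hL hf' (hμ.integrable_entry hN hL hf) hLip
  refine (measure_mono fun x hx => ?_).trans
    ((hμ.measure_le hN hc one_pos hL hδ (hLip (Matrix.of fun i j => ∫ z, f z i j ∂μ))).trans_eq
      ?_)
  · rw [Set.mem_ofPred_eq] at hx ⊢
    linarith
  · congr 2
    ring

end
end
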